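/- arXiv:2205.06582 — 2 statements merged into one kernel-verified Lean document; each statement's English description precedes it below -/
import Mathlib

section
/- Let V₀ : ℝ → ℝ be non-negative and single-well with (1+|x|)V₀(x) integrable over ℝ, and let V : ℝ → ℝ be measurable with positive part V₊ ∈ L²(ℝ). Suppose μ₁ > 0 and that −μ₁ is an eigenvalue of the Schrödinger operator −d²/dx² − V₀ on L²(ℝ) possessing a strictly positive eigenfunction (i.e. −μ₁ is the lowest eigenvalue). Then for every N ∈ ℕ and all distinct negative reals E₁, …, E_N, each of which is an eigenvalue of −d²/dx² − (V₀ + V) on L²(ℝ), one has Σ_{k=1}^N max(√|E_k| − √μ₁, 0)³ ≤ (3/16) ∫_ℝ V₊(x)² dx. -/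
open MeasureTheory Real Filter Set
open scoped Topology

/-- `E` is an eigenvalue of the Schrödinger operator `-d²/dx² - W` on `L²(ℝ)`:
there is a nonzero `ψ ∈ L²(ℝ)`, continuously differentiable with `ψ'` locally
absolutely continuous (encoded via a locally integrable a.e.-derivative `ψ''`
whose integral recovers `ψ'`), such that `-ψ'' - Wψ = Eψ` almost everywhere. -/
def IsEigenvalue (W : ℝ → ℝ) (E : ℝ) : Prop :=
  ∃ ψ ψ'' : ℝ → ℝ, ψ ≠ 0 ∧ MemLp ψ 2 (volume : Measure ℝ) ∧ ContDiff ℝ 1 ψ ∧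
    (∀ a b : ℝ, IntervalIntegrable ψ'' volume a b ∧
      ∫ x in a..b, ψ'' x = deriv ψ b - deriv ψ a) ∧
    (∀ᵐ x : ℝ ∂volume, -ψ'' x - W x * ψ x = E * ψ x)

/-- `E` is an eigenvalue of `-d²/dx² - W` possessing a strictly positive
eigenfunction (i.e. `E` is the lowest eigenvalue). -/
def IsEigenvalueWithPositiveEigenfunction (W : ℝ → ℝ) (E : ℝ) : Prop :=
  ∃ ψ ψ'' : ℝ → ℝ, (∀ x, 0 < ψ x) ∧ MemLp ψ 2 (volume : Measure ℝ) ∧ ContDiff ℝ 1 ψ ∧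
    (∀ a b : ℝ, IntervalIntegrable ψ'' volume a b ∧
      ∫ x in a..b, ψ'' x = deriv ψ b - deriv ψ a) ∧
    (∀ᵐ x : ℝ ∂volume, -ψ'' x - W x * ψ x = E * ψ x)

namespace LTaux

noncomputable def qf (f V : ℝ → ℝ) (m d a b : ℝ) (ψ : ℝ → ℝ) : ℝ :=
  (∫ x in a..b, ((deriv ψ x - f x * ψ x) ^ 2 - V x * ψ x ^ 2 + (d ^ 2 + 2 * m * d) * ψ x ^ 2))
    + d * (ψ a ^ 2 + ψ b ^ 2)

def NegD (f V : ℝ → ℝ) (m d a b : ℝ) (k : ℕ) : Prop :=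
  ∃ L : (Fin k → ℝ) →ₗ[ℝ] (ℝ → ℝ), (∀ c, ContDiff ℝ 1 (L c)) ∧
    ∀ c, c ≠ 0 → qf f V m d a b (L c) < 0

lemma ftc {g g' : ℝ → ℝ} {a b : ℝ} (hab : a ≤ b) (hg : Continuous g) (hg' : Continuous g')
    (h : ∀ x ∈ Ioo a b, HasDerivAt g (g' x) x) : ∫ x in a..b, g' x = g b - g a :=
  intervalIntegral.integral_eq_sub_of_hasDerivAt_of_le hab hg.continuousOn h
    (hg'.intervalIntegrable _ _)

lemma c1 {ψ : ℝ → ℝ} (h : ContDiff ℝ 1 ψ) :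
    Continuous ψ ∧ Continuous (deriv ψ) ∧ ∀ x, HasDerivAt ψ (deriv ψ x) x :=
  ⟨h.continuous, h.continuous_deriv le_rfl,
    fun x => (h.differentiable (by norm_num) x).hasDerivAt⟩

lemma qf_eq {f V G ψ : ℝ → ℝ} {m d a b : ℝ} (hab : a ≤ b) (hf : Continuous f) (hV : Continuous V)
    (hG : Continuous G) (hψ : ContDiff ℝ 1 ψ)
    (hR : ∀ x ∈ Ioo a b, HasDerivAt G (d ^ 2 + 2 * m * d - V x - G x ^ 2 - 2 * f x * G x) x) :
    qf f V m d a b ψ = (∫ x in a..b, (deriv ψ x - (f x + G x) * ψ x) ^ 2)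
      + (G b + d) * ψ b ^ 2 + (d - G a) * ψ a ^ 2 := by
  obtain ⟨h1, h2, h3⟩ := c1 hψ
  have := ftc (g := fun x => G x * ψ x ^ 2)
    (g' := fun x => (d ^ 2 + 2 * m * d - V x - G x ^ 2 - 2 * f x * G x) * ψ x ^ 2
      + G x * (2 * ψ x * deriv ψ x)) hab (by fun_prop) (by fun_prop) (by
      intro x hx
      have := (hR x hx).mul ((h3 x).pow 2)
      exact this.congr_deriv (by simp))
  unfold qf
  have e : ∫ x in a..b, ((deriv ψ x - f x * ψ x) ^ 2 - V x * ψ x ^ 2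
      + (d ^ 2 + 2 * m * d) * ψ x ^ 2) = (∫ x in a..b, (deriv ψ x - (f x + G x) * ψ x) ^ 2)
      + ∫ x in a..b, ((d ^ 2 + 2 * m * d - V x - G x ^ 2 - 2 * f x * G x) * ψ x ^ 2
      + G x * (2 * ψ x * deriv ψ x)) := by
    rw [← intervalIntegral.integral_add]
    · congr 1; ext x; ring
    · exact Continuous.intervalIntegrable (by fun_prop) _ _
    · exact Continuous.intervalIntegrable (by fun_prop) _ _
  rw [e, this]; ring

lemma qf_sub {f V ψ : ℝ → ℝ} {m d d' a b : ℝ} (hf : Continuous f) (hV : Continuous V)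
    (hψ : ContDiff ℝ 1 ψ) :
    qf f V m d a b ψ = qf f V m d' a b ψ
      - ((d' ^ 2 + 2 * m * d') - (d ^ 2 + 2 * m * d)) * (∫ x in a..b, ψ x ^ 2)
      - (d' - d) * (ψ a ^ 2 + ψ b ^ 2) := by
  obtain ⟨h1, h2, h3⟩ := c1 hψ
  unfold qf
  have e : ∫ x in a..b, ((deriv ψ x - f x * ψ x) ^ 2 - V x * ψ x ^ 2
      + (d ^ 2 + 2 * m * d) * ψ x ^ 2) = (∫ x in a..b, ((deriv ψ x - f x * ψ x) ^ 2 - V x * ψ x ^ 2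
      + (d' ^ 2 + 2 * m * d') * ψ x ^ 2))
      - ∫ x in a..b, ((d' ^ 2 + 2 * m * d') - (d ^ 2 + 2 * m * d)) * ψ x ^ 2 := by
    rw [← intervalIntegral.integral_sub]
    · congr 1; ext x; ring
    · exact Continuous.intervalIntegrable (by fun_prop) _ _
    · exact Continuous.intervalIntegrable (by fun_prop) _ _
  rw [e, intervalIntegral.integral_const_mul]; ring

lemma qf_mono_V {f V V' ψ : ℝ → ℝ} {m d a b : ℝ} (hab : a ≤ b) (hf : Continuous f)
    (hV : Continuous V) (hV' : Continuous V') (hψ : ContDiff ℝ 1 ψ) (h : ∀ x, V x ≤ V' x) :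
    qf f V' m d a b ψ ≤ qf f V m d a b ψ := by
  obtain ⟨h1, h2, h3⟩ := c1 hψ
  unfold qf
  gcongr
  refine intervalIntegral.integral_mono_on hab (Continuous.intervalIntegrable (by fun_prop) _ _)
    (Continuous.intervalIntegrable (by fun_prop) _ _) ?_
  intro x _
  have := mul_le_mul_of_nonneg_right (h x) (sq_nonneg (ψ x))
  linarith

/-- the gain of one commutation step -/
lemma gain {f f' V G : ℝ → ℝ} {m d a b : ℝ} (hab : a ≤ b)
    (hf : ∀ x, HasDerivAt f (f' x) x) (hf' : Continuous f') (hneg : ∀ x, f' x ≤ 0)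
    (hm : ∀ x, |f x| ≤ m) (hV : Continuous V) (hG : Continuous G)
    (hR : ∀ x ∈ Ioo a b, HasDerivAt G (d ^ 2 + 2 * m * d - V x - G x ^ 2 - 2 * f x * G x) x)
    (ha : G a = d) (hb : G b = -d) :
    16 / 3 * d ^ 3 + (∫ x in a..b,
      (max (2 * (d ^ 2 + 2 * m * d - G x ^ 2 - 2 * f x * G x) - V x) 0) ^ 2)
      ≤ ∫ x in a..b, V x ^ 2 := by
  have hfc : Continuous f := continuous_iff_continuousAt.2 fun x => (hf x).continuousAt
  set P := fun x => d ^ 2 + 2 * m * d - G x ^ 2 - 2 * f x * G x with hP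
  have hPc : Continuous P := by fun_prop
  have := ftc (g := fun x => -4 * ((d ^ 2 + 2 * m * d) * G x - G x ^ 3 / 3 - f x * G x ^ 2))
    (g' := fun x => -4 * (P x * (P x - V x) - f' x * G x ^ 2)) hab (by fun_prop) (by fun_prop) (by
      intro x hx
      have h1 := hR x hx
      have := ((((h1.const_mul (d ^ 2 + 2 * m * d)).sub ((h1.pow 3).div_const 3)).sub
        ((hf x).mul (h1.pow 2))).const_mul (-4))
      exact this.congr_deriv (by simp [hP]; ring))
  simp only [ha, hb] at this
  have key : (∫ x in a..b, -4 * (P x * (P x - V x) - f' x * G x ^ 2))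
      + ∫ x in a..b, (max (2 * P x - V x) 0) ^ 2 ≤ ∫ x in a..b, V x ^ 2 := by
    rw [← intervalIntegral.integral_add (Continuous.intervalIntegrable (by fun_prop) _ _)
      (Continuous.intervalIntegrable (by fun_prop) _ _)]
    refine intervalIntegral.integral_mono_on hab (Continuous.intervalIntegrable (by fun_prop) _ _)
      (Continuous.intervalIntegrable (by fun_prop) _ _) ?_
    intro x _
    have e1 : (max (2 * P x - V x) 0) ^ 2 ≤ (2 * P x - V x) ^ 2 := by
      rcases le_total (2 * P x - V x) 0 with h | h
      · rw [max_eq_right h]; nlinarith [sq_nonneg (2 * P x - V x)]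
      · rw [max_eq_left h]
    have e2 := mul_nonpos_of_nonpos_of_nonneg (hneg x) (sq_nonneg (G x))
    nlinarith
  have h1 := abs_le.1 (hm a)
  have h2 := abs_le.1 (hm b)
  have h3 : 0 ≤ d ^ 2 * (2 * m - f a + f b) := by
    apply mul_nonneg (by positivity); linarith [h1.2, h2.1]
  rw [this] at key
  nlinarith

lemma commute {f f' V G u : ℝ → ℝ} {m d d' a b : ℝ} (hab : a ≤ b) (hd : 0 ≤ d) (hdd : d < d')
    (hf : ∀ x, HasDerivAt f (f' x) x) (hf' : Continuous f') (hneg : ∀ x, f' x ≤ 0)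
    (hm : ∀ x, |f x| ≤ m) (hV : Continuous V) (hG : Continuous G)
    (hR : ∀ x ∈ Ioo a b, HasDerivAt G (d' ^ 2 + 2 * m * d' - V x - G x ^ 2 - 2 * f x * G x) x)
    (ha : G a = d') (hb : G b = -d') (hu : ∀ x, 0 < u x)
    (hu' : ∀ x, HasDerivAt u ((f x + G x) * u x) x) 
    {ψ v : ℝ → ℝ} (hψ : ContDiff ℝ 1 ψ) (hq : qf f V m d a b ψ < 0)
    (hv : ∀ x, v x = - (u x)⁻¹ * ((d' - d) * (ψ a * u a)
      + ((d' ^ 2 + 2 * m * d') - (d ^ 2 + 2 * m * d)) * ∫ t in a..x, ψ t * u t))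
    (hl : (d' - d) * (ψ a * u a + ψ b * u b)
      + ((d' ^ 2 + 2 * m * d') - (d ^ 2 + 2 * m * d)) * (∫ t in a..b, ψ t * u t) = 0) :
    ContDiff ℝ 1 v ∧ qf f (fun x => max (2 * (d' ^ 2 + 2 * m * d' - G x ^ 2 - 2 * f x * G x) - V x) 0)
      m d a b v < 0 := by
  have hfc : Continuous f := continuous_iff_continuousAt.2 fun x => (hf x).continuousAt
  have huc : Continuous u := continuous_iff_continuousAt.2 fun x => (hu' x).continuousAt
  obtain ⟨h1, h2, h3⟩ := c1 hψ
  set κ := (d' ^ 2 + 2 * m * d') - (d ^ 2 + 2 * m * d) with hκ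
  set τ := d' - d with hτ
  have hm0 : 0 ≤ m := (abs_nonneg _).trans (hm a)
  have hτ0 : 0 < τ := sub_pos.2 hdd
  have hκτ : κ = τ * (d' + d + 2 * m) := by rw [hκ, hτ]; ring
  have hκ0 : 0 < κ := by rw [hκτ]; apply mul_pos hτ0; linarith
  have hvd : ∀ x, HasDerivAt v (-κ * ψ x - (f x + G x) * v x) x := by
    intro x
    have i1 : HasDerivAt (fun x => ∫ t in a..x, ψ t * u t) (ψ x * u x) x :=
      intervalIntegral.integral_hasDerivAt_right
        (Continuous.intervalIntegrable (by fun_prop) _ _)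
        (Continuous.stronglyMeasurableAtFilter (by fun_prop) _ _)
        (Continuous.continuousAt (by fun_prop))
    have i2 := ((hu' x).inv (hu x).ne').neg.mul ((i1.const_mul κ).const_add (τ * (ψ a * u a)))
    have e : v = _ := funext hv
    rw [e]
    have := (hu x).ne'
    refine i2.congr_deriv ?_
    simp
    field_simp
    ring
  have hvc : Continuous v := continuous_iff_continuousAt.2 fun x => (hvd x).continuousAt
  have hvder : deriv v = fun x => -κ * ψ x - (f x + G x) * v x := funext fun x => (hvd x).deriv
  have hv1 : ContDiff ℝ 1 v := by
    rw [contDiff_one_iff_deriv]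
    refine ⟨fun x => (hvd x).differentiableAt, ?_⟩
    rw [hvder]; fun_prop
  refine ⟨hv1, ?_⟩
  have va : v a = -τ * ψ a := by
    rw [hv]; have := (hu a).ne'; simp; field_simp
  have vb : v b = τ * ψ b := by
    rw [hv]; have := (hu b).ne'
    have : τ * (ψ a * u a) + κ * (∫ t in a..b, ψ t * u t) = - τ * (ψ b * u b) := by linarith
    rw [this]; field_simp
  -- step 1
  have s1 : (∫ x in a..b, (deriv ψ x - (f x + G x) * ψ x) ^ 2)
      < κ * (∫ x in a..b, ψ x ^ 2) + τ * (ψ a ^ 2 + ψ b ^ 2) := by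
    rw [qf_sub (d' := d') hfc hV hψ, qf_eq hab hfc hV hG hψ hR, ha, hb] at hq
    nlinarith
  -- step 2
  have s2 : ∫ x in a..b, v x * (deriv ψ x - (f x + G x) * ψ x)
      = κ * (∫ x in a..b, ψ x ^ 2) + τ * (ψ a ^ 2 + ψ b ^ 2) := by
    have := ftc (g := fun x => v x * ψ x) (g' := fun x => (-κ * ψ x - (f x + G x) * v x) * ψ x
      + v x * deriv ψ x) hab (by fun_prop) (by fun_prop) (fun x _ => (hvd x).mul (h3 x))
    have e : (∫ x in a..b, v x * (deriv ψ x - (f x + G x) * ψ x)) =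
        (∫ x in a..b, ((-κ * ψ x - (f x + G x) * v x) * ψ x
      + v x * deriv ψ x)) + ∫ x in a..b, κ * ψ x ^ 2 := by
      rw [← intervalIntegral.integral_add (Continuous.intervalIntegrable (by fun_prop) _ _)
        (Continuous.intervalIntegrable (by fun_prop) _ _)]
      congr 1; ext x; ring
    rw [e, this, intervalIntegral.integral_const_mul, va, vb]; ring
  have s3 : 0 ≤ ∫ x in a..b, (v x - (deriv ψ x - (f x + G x) * ψ x)) ^ 2 :=
    intervalIntegral.integral_nonneg hab fun x _ => sq_nonneg _
  have s4 : ∫ x in a..b, (v x - (deriv ψ x - (f x + G x) * ψ x)) ^ 2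
     = (∫ x in a..b, v x ^ 2) - 2 * (∫ x in a..b, v x * (deriv ψ x - (f x + G x) * ψ x))
      + ∫ x in a..b, (deriv ψ x - (f x + G x) * ψ x) ^ 2 := by
    rw [← intervalIntegral.integral_const_mul,
      ← intervalIntegral.integral_sub (Continuous.intervalIntegrable (by fun_prop) _ _)
        (Continuous.intervalIntegrable (by fun_prop) _ _),
      ← intervalIntegral.integral_add (Continuous.intervalIntegrable (by fun_prop) _ _)
        (Continuous.intervalIntegrable (by fun_prop) _ _)]
    congr 1; ext x; ring
  have s5 : κ * (∫ x in a..b, ψ x ^ 2) + τ * (ψ a ^ 2 + ψ b ^ 2) < ∫ x in a..b, v x ^ 2 := by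
    linarith
  -- step 3
  set P := fun x => d' ^ 2 + 2 * m * d' - G x ^ 2 - 2 * f x * G x with hP
  have hPc : Continuous P := by fun_prop
  refine lt_of_le_of_lt (qf_mono_V (V := fun x => 2 * P x - V x) hab hfc (by fun_prop)
    (by fun_prop) hv1 (fun x => le_max_left _ _)) ?_
  have t1 := ftc (g := fun x => (2 * f x + G x) * v x ^ 2)
    (g' := fun x => (2 * f' x + (P x - V x)) * v x ^ 2
      + (2 * f x + G x) * (2 * v x * (-κ * ψ x - (f x + G x) * v x))) hab
      (by fun_prop) (by fun_prop) (by
      intro x hx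
      have hRx := hR x hx
      have := (((hf x).const_mul 2).add hRx).mul ((hvd x).pow 2)
      exact this.congr_deriv (by simp only [Pi.pow_apply, Pi.add_apply, hP]; push_cast; ring))
  have t2 : qf f (fun x => 2 * P x - V x) m d a b v
      ≤ (κ ^ 2 * (∫ x in a..b, ψ x ^ 2)) - ((2 * f b + G b) * v b ^ 2 - (2 * f a + G a) * v a ^ 2)
        - κ * (∫ x in a..b, v x ^ 2) + d * (v a ^ 2 + v b ^ 2) := by
    unfold qf
    rw [← t1, ← intervalIntegral.integral_const_mul, ← intervalIntegral.integral_const_mul,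
      ← intervalIntegral.integral_sub (Continuous.intervalIntegrable (by fun_prop) _ _)
        (Continuous.intervalIntegrable (by fun_prop) _ _),
      ← intervalIntegral.integral_sub (Continuous.intervalIntegrable (by fun_prop) _ _)
        (Continuous.intervalIntegrable (by fun_prop) _ _), hvder]
    gcongr
    refine intervalIntegral.integral_mono_on hab (Continuous.intervalIntegrable (by fun_prop) _ _)
      (Continuous.intervalIntegrable (by fun_prop) _ _) ?_
    intro x _
    have e2 := mul_nonpos_of_nonpos_of_nonneg (hneg x) (sq_nonneg (v x))
    have : κ ^ 2 * ψ x ^ 2 - ((2 * f' x + (P x - V x)) * v x ^ 2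
      + (2 * f x + G x) * (2 * v x * (-κ * ψ x - (f x + G x) * v x))) - κ * v x ^ 2
      - ((-κ * ψ x - (f x + G x) * v x - f x * v x) ^ 2 - (2 * P x - V x) * v x ^ 2
      + (d ^ 2 + 2 * m * d) * v x ^ 2) = -2 * (f' x * v x ^ 2) := by
      rw [hκ]; simp only [hP]; ring
    linarith
  have t3 := mul_lt_mul_of_pos_left s5 hκ0
  rw [va, vb, ha, hb] at t2
  have h1 := abs_le.1 (hm a)
  have h2 := abs_le.1 (hm b)
  have h4 : 0 ≤ τ ^ 2 * ψ a ^ 2 * (m - f a) := by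
    apply mul_nonneg (by positivity); linarith [h1.2]
  have h5 : 0 ≤ τ ^ 2 * ψ b ^ 2 * (m + f b) := by
    apply mul_nonneg (by positivity); linarith [h2.1]
  have e1 : κ * (τ * (ψ a ^ 2 + ψ b ^ 2)) = τ ^ 2 * (d' + d + 2 * m) * (ψ a ^ 2 + ψ b ^ 2) := by
    rw [hκτ]; ring
  linarith
end LTaux

namespace LTaux

lemma bar_fwd {θ θ' : ℝ → ℝ} {a b c : ℝ} (h : ∀ x ∈ Icc a b, HasDerivAt θ (θ' x) x)
    (hc : ∀ x ∈ Icc a b, θ x = c → θ' x < 0) (ha : θ a ≤ c) : ∀ x ∈ Icc a b, θ x ≤ c := by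
  intro x hx
  exact image_le_of_deriv_right_lt_deriv_boundary (f := θ) (f' := θ') (B := fun _ => c)
    (B' := fun _ => 0) (fun x hx => (h x hx).continuousAt.continuousWithinAt)
    (fun x hx => (h x ⟨hx.1, hx.2.le⟩).hasDerivWithinAt) ha (fun x => hasDerivAt_const x c)
    (fun x hx => hc x ⟨hx.1, hx.2.le⟩) hx

lemma bar_bwd {θ θ' : ℝ → ℝ} {a b c : ℝ} (h : ∀ x ∈ Icc a b, HasDerivAt θ (θ' x) x)
    (hc : ∀ x ∈ Icc a b, θ x = c → θ' x < 0) (hb : c ≤ θ b) : ∀ x ∈ Icc a b, c ≤ θ x := by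
  intro x hx
  have := bar_fwd (θ := fun t => - θ (-t)) (θ' := fun t => θ' (-t)) (a := -b) (b := -a) (c := -c)
    (by
      intro t ht
      have h1 := h (-t) ⟨by linarith [ht.2], by linarith [ht.1]⟩
      have h2 := (h1.comp t (hasDerivAt_neg t)).neg
      exact h2.congr_deriv (by ring))
    (by
      intro t ht e
      exact hc (-t) ⟨by linarith [ht.2], by linarith [ht.1]⟩ (by linarith))
    (by simpa using hb) (-x) ⟨by linarith [hx.2], by linarith [hx.1]⟩
  simpa using this

noncomputable def X (f V : ℝ → ℝ) (δ x θ : ℝ) : ℝ :=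
  (δ - V x) * cos θ ^ 2 - sin θ ^ 2 - 2 * f x * (sin θ * cos θ)

lemma X_lip {f V : ℝ → ℝ} {δ x M : ℝ} (hM : 0 ≤ M) (hf : |f x| ≤ M) (hV : |V x| ≤ M) :
    LipschitzWith (Real.toNNReal (2 * (|δ| + M) + 2 + 4 * M)) (X f V δ x) := by
  have hd : ∀ θ, HasDerivAt (X f V δ x)
      (-(2 * (δ - V x)) * (cos θ * sin θ) - 2 * (sin θ * cos θ)
        - 2 * f x * (cos θ * cos θ - sin θ * sin θ)) θ := by
    intro θ
    have h1 := (((hasDerivAt_cos θ).pow 2).const_mul (δ - V x)).sub ((hasDerivAt_sin θ).pow 2)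
    have h2 := ((hasDerivAt_sin θ).mul (hasDerivAt_cos θ)).const_mul (2 * f x)
    exact (h1.sub h2).congr_deriv (by simp; ring)
  apply lipschitzWith_of_nnnorm_deriv_le (fun θ => (hd θ).differentiableAt)
  intro θ
  rw [(hd θ).deriv]
  rw [← NNReal.coe_le_coe, coe_nnnorm, Real.coe_toNNReal _ (by positivity), Real.norm_eq_abs]
  have hs := abs_sin_le_one θ
  have hc := abs_cos_le_one θ
  have e1 : |cos θ * sin θ| ≤ 1 := by rw [abs_mul]; nlinarith [abs_nonneg (sin θ), abs_nonneg (cos θ)]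
  have e2 : |sin θ * cos θ| ≤ 1 := by rw [mul_comm]; exact e1
  have e3 : |cos θ * cos θ - sin θ * sin θ| ≤ 2 := by
    rw [abs_le]; constructor <;> nlinarith [sin_sq_add_cos_sq θ, sq_nonneg (sin θ), sq_nonneg (cos θ)]
  have e4 : |δ - V x| ≤ |δ| + M := (abs_sub _ _).trans (by linarith)
  have a1 : |-(2 * (δ - V x)) * (cos θ * sin θ)| ≤ 2 * (|δ| + M) := by
    rw [abs_mul, abs_neg, abs_mul, abs_two]
    nlinarith [abs_nonneg (δ - V x), abs_nonneg (cos θ * sin θ), abs_nonneg δ]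
  have a2 : |2 * (sin θ * cos θ)| ≤ 2 := by rw [abs_mul, abs_two]; linarith
  have a3 : |2 * f x * (cos θ * cos θ - sin θ * sin θ)| ≤ 4 * M := by
    rw [abs_mul, abs_mul, abs_two]
    nlinarith [abs_nonneg (f x), abs_nonneg (cos θ * cos θ - sin θ * sin θ)]
  exact (abs_sub _ _).trans ((add_le_add (abs_sub _ _) le_rfl).trans (by linarith))

lemma X_bd {f V : ℝ → ℝ} {δ x M : ℝ} (hM : 0 ≤ M) (hf : |f x| ≤ M) (hV : |V x| ≤ M) (θ : ℝ) :
    |X f V δ x θ| ≤ |δ| + M + 1 + 2 * M := by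
  unfold X
  have hs := abs_sin_le_one θ
  have hc := abs_cos_le_one θ
  have e2 : |sin θ * cos θ| ≤ 1 := by rw [abs_mul]; nlinarith [abs_nonneg (sin θ), abs_nonneg (cos θ)]
  have e4 : |δ - V x| ≤ |δ| + M := (abs_sub _ _).trans (by linarith)
  have a1 : |(δ - V x) * cos θ ^ 2| ≤ |δ| + M := by
    rw [abs_mul, abs_of_nonneg (sq_nonneg (cos θ))]
    nlinarith [abs_nonneg (δ - V x), sin_sq_add_cos_sq θ, sq_nonneg (sin θ)]
  have a2 : |sin θ ^ 2| ≤ 1 := by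
    rw [abs_of_nonneg (sq_nonneg _)]; nlinarith [sin_sq_add_cos_sq θ, sq_nonneg (cos θ)]
  have a3 : |2 * f x * (sin θ * cos θ)| ≤ 2 * M := by
    rw [abs_mul, abs_mul, abs_two]
    nlinarith [abs_nonneg (f x), abs_nonneg (sin θ * cos θ)]
  exact (abs_sub _ _).trans ((add_le_add (abs_sub _ _) le_rfl).trans (by linarith))

lemma exists_bd {f V : ℝ → ℝ} (hf : Continuous f) (hV : Continuous V) (a b : ℝ) :
    ∃ M, 0 ≤ M ∧ ∀ x ∈ Icc a b, |f x| ≤ M ∧ |V x| ≤ M := by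
  obtain ⟨C, hC⟩ := isCompact_Icc.exists_bound_of_continuousOn (s := Icc a b) hf.continuousOn
  obtain ⟨D, hD⟩ := isCompact_Icc.exists_bound_of_continuousOn (s := Icc a b) hV.continuousOn
  refine ⟨max (max C D) 0, le_max_right _ _, fun x hx => ⟨?_, ?_⟩⟩
  · exact (hC x hx).trans (le_max_of_le_left (le_max_left _ _))
  · exact (hD x hx).trans (le_max_of_le_left (le_max_right _ _))

lemma prufer_one {f V : ℝ → ℝ} (hf : Continuous f) (hV : Continuous V) {a b : ℝ} (hab : a ≤ b)
    (δ θ₀ : ℝ) : ∃ θ : ℝ → ℝ, θ a = θ₀ ∧ ∀ x ∈ Icc a b, HasDerivAt θ (X f V δ x (θ x)) x := by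
  obtain ⟨M, hM, hb⟩ := exists_bd hf hV (a-1) (b+1)
  set L := |δ| + M + 1 + 2 * M
  have hL : 0 ≤ L := by positivity
  have hP : IsPicardLindelof (X f V δ) (tmin := a - 1) (tmax := b + 1) ⟨a, by linarith, by linarith⟩
      θ₀ (Real.toNNReal (L * (b - a + 1))) 0 (Real.toNNReal L)
      (Real.toNNReal (2 * (|δ| + M) + 2 + 4 * M)) :=
    { lipschitzOnWith := fun t ht => (X_lip hM (hb t ht).1 (hb t ht).2).lipschitzOnWith
      continuousOn := fun x _ => by unfold X; fun_prop
      norm_le := fun t ht x _ => by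
        rw [Real.coe_toNNReal _ hL]; exact X_bd hM (hb t ht).1 (hb t ht).2 x
      mul_max_le := by
        rw [Real.coe_toNNReal _ hL, Real.coe_toNNReal _ (by apply mul_nonneg hL; linarith)]
        simp only [NNReal.coe_zero, sub_zero]
        apply mul_le_mul_of_nonneg_left _ hL
        apply max_le <;> linarith }
  obtain ⟨θ, h1, h2⟩ := hP.exists_eq_forall_mem_Icc_hasDerivWithinAt₀
  refine ⟨θ, h1, fun x hx => ?_⟩
  exact (h2 x ⟨by linarith [hx.1], by linarith [hx.2]⟩).hasDerivAt
    (Icc_mem_nhds (by linarith [hx.1]) (by linarith [hx.2]))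

lemma prufer {f V : ℝ → ℝ} (hf : Continuous f) (hV : Continuous V) {a b : ℝ} (hab : a ≤ b)
    (m : ℝ) : ∃ Θ : ℝ → ℝ → ℝ, (∀ d, Θ d a = arctan d) ∧
      (∀ d, ∀ x ∈ Icc a b, HasDerivAt (Θ d) (X f V (d ^ 2 + 2 * m * d) x (Θ d x)) x) ∧
      Continuous fun d => Θ d b := by
  choose Θ h1 h2 using fun d : ℝ => prufer_one hf hV hab (d ^ 2 + 2 * m * d) (arctan d)
  refine ⟨Θ, h1, h2, ?_⟩
  obtain ⟨M, hM, hb⟩ := exists_bd hf hV a b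
  rw [continuous_iff_continuousAt]
  intro d₀
  set δ₀ := d₀ ^ 2 + 2 * m * d₀
  set K := 2 * (|δ₀| + M) + 2 + 4 * M
  have hK : 0 < K := by positivity
  have key : ∀ d, dist (Θ d b) (Θ d₀ b) ≤
      gronwallBound |arctan d - arctan d₀| K (|d ^ 2 + 2 * m * d - δ₀|) (b - a) := by
    intro d
    have := dist_le_of_approx_trajectories_ODE_of_mem (v := X f V δ₀) (K := Real.toNNReal K)
      (s := fun _ => univ) (f := Θ d) (g := Θ d₀) (a := a) (b := b)
      (f' := fun t => X f V (d ^ 2 + 2 * m * d) t (Θ d t)) (g' := fun t => X f V δ₀ t (Θ d₀ t))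
      (εf := |d ^ 2 + 2 * m * d - δ₀|) (εg := 0) (δ := |arctan d - arctan d₀|)
      (fun t ht => (X_lip hM (hb t ⟨ht.1, ht.2.le⟩).1 (hb t ⟨ht.1, ht.2.le⟩).2).lipschitzOnWith)
      (fun t ht => (h2 d t ht).continuousAt.continuousWithinAt)
      (fun t ht => (h2 d t ⟨ht.1, ht.2.le⟩).hasDerivWithinAt)
      (fun t ht => by
        rw [Real.dist_eq]
        have : X f V (d ^ 2 + 2 * m * d) t (Θ d t) - X f V δ₀ t (Θ d t)
          = (d ^ 2 + 2 * m * d - δ₀) * cos (Θ d t) ^ 2 := by unfold X; ring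
        rw [this, abs_mul, abs_of_nonneg (sq_nonneg (cos _))]
        nlinarith [abs_nonneg (d ^ 2 + 2 * m * d - δ₀), sin_sq_add_cos_sq (Θ d t),
          sq_nonneg (sin (Θ d t))])
      (fun _ _ => trivial)
      (fun t ht => (h2 d₀ t ht).continuousAt.continuousWithinAt)
      (fun t ht => (h2 d₀ t ⟨ht.1, ht.2.le⟩).hasDerivWithinAt)
      (fun t ht => by simp) (fun _ _ => trivial)
      (by rw [h1, h1, Real.dist_eq]) b ⟨hab, le_rfl⟩
    rwa [add_zero, Real.coe_toNNReal _ hK.le] at this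
  rw [ContinuousAt, tendsto_iff_dist_tendsto_zero]
  refine squeeze_zero (fun _ => dist_nonneg) key ?_
  have hcont : Continuous fun d => gronwallBound |arctan d - arctan d₀| K
      (|d ^ 2 + 2 * m * d - δ₀|) (b - a) := by
    simp only [gronwallBound_of_K_ne_0 hK.ne']
    have := continuous_arctan
    fun_prop
  have := hcont.tendsto d₀
  simpa [δ₀, gronwallBound_ε0] using this

lemma ground {f V : ℝ → ℝ} (hf : Continuous f) (hV : Continuous V) {a b : ℝ} (hab : a ≤ b)
    {m d₀ : ℝ} (hm : 0 ≤ m) (hd₀ : 0 ≤ d₀) {ψ : ℝ → ℝ} (hψ : ContDiff ℝ 1 ψ)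
    (hq : qf f V m d₀ a b ψ < 0) :
    ∃ d' G, d₀ ≤ d' ∧ Continuous G ∧
      (∀ x ∈ Ioo a b, HasDerivAt G (d' ^ 2 + 2 * m * d' - V x - G x ^ 2 - 2 * f x * G x) x) ∧
      G a = d' ∧ G b = -d' := by
  obtain ⟨Θ, h1, h2, h3⟩ := prufer hf hV hab m
  have hbar : ∀ d, ∀ c, cos c = 0 → ∀ x ∈ Icc a b, Θ d x = c →
      X f V (d ^ 2 + 2 * m * d) x (Θ d x) < 0 := by
    intro d c hc x _ hx
    have : sin c ^ 2 = 1 := by nlinarith [sin_sq_add_cos_sq c]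
    rw [hx]; unfold X; rw [hc, this]; norm_num
  have hup : ∀ d, ∀ x ∈ Icc a b, Θ d x < π / 2 := by
    intro d x hx
    by_contra! hcon
    have := bar_bwd (θ := Θ d) (a := a) (b := x) (c := π / 2)
      (fun y hy => h2 d y ⟨hy.1, hy.2.trans hx.2⟩)
      (fun y hy => hbar d _ cos_pi_div_two y ⟨hy.1, hy.2.trans hx.2⟩) hcon a ⟨le_rfl, hx.1⟩
    rw [h1] at this
    linarith [arctan_lt_pi_div_two d]
  have hlo : ∀ d, -(π / 2) < Θ d b → ∀ x ∈ Icc a b, -(π / 2) < Θ d x := by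
    intro d hd x hx
    by_contra! hcon
    have := bar_fwd (θ := Θ d) (a := x) (b := b) (c := -(π / 2))
      (fun y hy => h2 d y ⟨hx.1.trans hy.1, hy.2⟩)
      (fun y hy => hbar d _ (by simp) y ⟨hx.1.trans hy.1, hy.2⟩) hcon b ⟨hx.2, le_rfl⟩
    linarith
  have mkG : ∀ d, -(π / 2) < Θ d b → ∃ G, Continuous G ∧
      (∀ x ∈ Ioo a b, HasDerivAt G (d ^ 2 + 2 * m * d - V x - G x ^ 2 - 2 * f x * G x) x) ∧
      G a = d ∧ G b = tan (Θ d b) := by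
    intro d hd
    have hmem : ∀ x, max a (min b x) ∈ Icc a b := fun x =>
      ⟨le_max_left _ _, max_le hab (min_le_left _ _)⟩
    have hcos : ∀ x ∈ Icc a b, 0 < cos (Θ d x) := fun x hx =>
      cos_pos_of_mem_Ioo ⟨hlo d hd x hx, hup d x hx⟩
    refine ⟨fun x => tan (Θ d (max a (min b x))), ?_, ?_, ?_, ?_⟩
    · have hc : ContinuousOn (fun x => tan (Θ d x)) (Icc a b) := by
        intro x hx
        exact (((hasDerivAt_tan (hcos x hx).ne').continuousAt).comp
          (h2 d x hx).continuousAt).continuousWithinAt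
      exact hc.comp_continuous (by fun_prop) hmem
    · intro x hx
      have hx' : x ∈ Icc a b := ⟨hx.1.le, hx.2.le⟩
      have e : ∀ y ∈ Ioo a b, max a (min b y) = y := fun y hy => by
        rw [min_eq_right hy.2.le, max_eq_right hy.1.le]
      have h4 := (hasDerivAt_tan (hcos x hx').ne').comp x (h2 d x hx')
      have h5 : HasDerivAt (fun x => tan (Θ d (max a (min b x))))
          (1 / cos (Θ d x) ^ 2 * X f V (d ^ 2 + 2 * m * d) x (Θ d x)) x := by
        refine h4.congr_of_eventuallyEq ?_
        filter_upwards [Ioo_mem_nhds hx.1 hx.2] with y hy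
        simp [e y hy]
      refine h5.congr_deriv ?_
      simp only [e x hx]
      have := (hcos x hx').ne'
      rw [tan_eq_sin_div_cos]; unfold X
      field_simp
      try ring
    · simp [hab, h1]
    · simp [hab]
  set h : ℝ → ℝ := fun d => Θ d b + arctan d with hh
  have hcont : Continuous h := h3.add continuous_arctan
  have h0 : h d₀ ≤ 0 := by
    by_contra! hcon
    have hd : -(π / 2) < Θ d₀ b := by
      have := arctan_lt_pi_div_two d₀
      simp only [hh] at hcon; linarith
    obtain ⟨G, g1, g2, g3, g4⟩ := mkG d₀ hd
    rw [qf_eq hab hf hV g1 hψ g2] at hq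
    have i1 : 0 ≤ ∫ x in a..b, (deriv ψ x - (f x + G x) * ψ x) ^ 2 :=
      intervalIntegral.integral_nonneg hab (fun x _ => sq_nonneg _)
    have : -d₀ < G b := by
      have e0 : -d₀ = tan (-arctan d₀) := by rw [tan_neg, tan_arctan]
      rw [g4, e0]
      apply tan_lt_tan_of_lt_of_lt_pi_div_two
      · linarith [arctan_lt_pi_div_two d₀]
      · exact hup d₀ b ⟨hab, le_rfl⟩
      · simp only [hh] at hcon; linarith
    rw [g3] at hq
    nlinarith [mul_nonneg (by linarith : 0 ≤ G b + d₀) (sq_nonneg (ψ b))]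
  obtain ⟨M, hM, hMb⟩ := exists_bd hf hV a b
  set D := max (M + 1) d₀ with hD
  have hDM : M + 1 ≤ D := le_max_left _ _
  have h9 : 0 ≤ h D := by
    have hDp : 0 ≤ arctan D := by
      rw [← arctan_zero]; exact arctan_mono (by linarith)
    have := bar_fwd (θ := fun x => - Θ D x) (θ' := fun x => - X f V (D ^ 2 + 2 * m * D) x (Θ D x))
      (a := a) (b := b) (c := 0)
      (fun x hx => (h2 D x hx).neg)
      (fun x hx hx0 => by
        have : Θ D x = 0 := by linarith
        rw [this]; unfold X; simp
        have := (abs_le.1 (hMb x hx).2).2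
        nlinarith [mul_nonneg hm (by linarith : 0 ≤ D)])
      (by rw [h1]; linarith) b ⟨hab, le_rfl⟩
    simp only [hh]; linarith
  obtain ⟨d', hd', hz⟩ := intermediate_value_Icc (le_max_right (M + 1) d₀) hcont.continuousOn
    (show (0 : ℝ) ∈ Icc (h d₀) (h D) from ⟨h0, h9⟩)
  have hz' : Θ d' b = arctan (-d') := by rw [arctan_neg]; simp only [hh] at hz; linarith
  obtain ⟨G, g1, g2, g3, g4⟩ := mkG d' (by rw [hz']; exact neg_pi_div_two_lt_arctan _)
  exact ⟨d', G, hd'.1, g1, g2, g3, by rw [g4, hz', tan_arctan]⟩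

end LTaux

namespace LTaux

lemma NegD_step {f f' V G : ℝ → ℝ} {m d d' a b : ℝ} {k : ℕ} (hab : a ≤ b) (hd : 0 ≤ d) (hdd : d < d')
    (hf : ∀ x, HasDerivAt f (f' x) x) (hf' : Continuous f') (hneg : ∀ x, f' x ≤ 0)
    (hm : ∀ x, |f x| ≤ m) (hV : Continuous V) (hG : Continuous G)
    (hR : ∀ x ∈ Ioo a b, HasDerivAt G (d' ^ 2 + 2 * m * d' - V x - G x ^ 2 - 2 * f x * G x) x)
    (ha : G a = d') (hb : G b = -d') (hN : NegD f V m d a b (k + 1)) :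
    NegD f (fun x => max (2 * (d' ^ 2 + 2 * m * d' - G x ^ 2 - 2 * f x * G x) - V x) 0)
      m d a b k := by
  have hfc : Continuous f := continuous_iff_continuousAt.2 fun x => (hf x).continuousAt
  obtain ⟨L, hL, hLq⟩ := hN
  set u : ℝ → ℝ := fun x => exp (∫ t in a..x, (f t + G t)) with hu
  have hfg : Continuous fun t => f t + G t := hfc.add hG
  have hu' : ∀ x, HasDerivAt u ((f x + G x) * u x) x := by
    intro x
    have := (hfg.integral_hasStrictDerivAt a x).hasDerivAt.exp
    exact this.congr_deriv (by rw [mul_comm])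
  have huc : Continuous u := continuous_iff_continuousAt.2 fun x => (hu' x).continuousAt
  set κ := (d' ^ 2 + 2 * m * d') - (d ^ 2 + 2 * m * d) with hκ
  have hLc : ∀ c, Continuous (L c) := fun c => (hL c).continuous
  have hii : ∀ c x y, IntervalIntegrable (fun t => L c t * u t) volume x y := fun c x y =>
    ((hLc c).mul huc).intervalIntegrable _ _
  have iadd : ∀ c e x y, ∫ t in x..y, L (c + e) t * u t
      = (∫ t in x..y, L c t * u t) + ∫ t in x..y, L e t * u t := by
    intro c e x y
    rw [← intervalIntegral.integral_add (hii _ _ _) (hii _ _ _)]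
    congr 1; ext t; rw [map_add, Pi.add_apply]; ring
  have ismul : ∀ (r : ℝ) c x y, ∫ t in x..y, L (r • c) t * u t
      = r * (∫ t in x..y, L c t * u t) := by
    intro r c x y
    rw [← intervalIntegral.integral_const_mul]
    congr 1; ext t; rw [map_smul, Pi.smul_apply, smul_eq_mul]; ring
  let ℓ : (Fin (k + 1) → ℝ) →ₗ[ℝ] ℝ :=
    { toFun := fun c => (d' - d) * (L c a * u a + L c b * u b) + κ * ∫ t in a..b, L c t * u t
      map_add' := fun c e => by
        rw [iadd, map_add, Pi.add_apply, Pi.add_apply]; ring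
      map_smul' := fun r c => by
        rw [ismul, map_smul, Pi.smul_apply, Pi.smul_apply]; simp only [smul_eq_mul, RingHom.id_apply]
        ring }
  have hker : k ≤ Module.finrank ℝ (LinearMap.ker ℓ) := by
    have h1 := LinearMap.finrank_range_add_finrank_ker ℓ
    have h2 : Module.finrank ℝ (LinearMap.range ℓ) ≤ 1 := by
      simpa using Submodule.finrank_le (LinearMap.range ℓ)
    simp at h1
    omega
  obtain ⟨w, hw⟩ := exists_linearIndependent_of_le_finrank hker
  let j : (Fin k → ℝ) →ₗ[ℝ] (Fin (k + 1) → ℝ) :=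
    (LinearMap.ker ℓ).subtype ∘ₗ Fintype.linearCombination ℝ w
  have hj0 : ∀ c, ℓ (j c) = 0 := fun c => (Fintype.linearCombination ℝ w c).2
  have hjinj : ∀ c, c ≠ 0 → j c ≠ 0 := by
    intro c hc hjc
    apply hc
    have h1 : Fintype.linearCombination ℝ w c = 0 := by
      apply Subtype.ext; exact hjc
    have h2 := LinearMap.ker_eq_bot.1 (LinearMap.ker_eq_bot.2 hw.fintypeLinearCombination_injective)
    exact h2 (by rw [h1, map_zero])
  let L' : (Fin k → ℝ) →ₗ[ℝ] (ℝ → ℝ) :=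
    { toFun := fun c x => -(u x)⁻¹ * ((d' - d) * (L (j c) a * u a) + κ * ∫ t in a..x, L (j c) t * u t)
      map_add' := fun c e => by
        ext x
        simp only [Pi.add_apply]
        rw [map_add, iadd, map_add, Pi.add_apply]; ring
      map_smul' := fun r c => by
        ext x
        simp only [Pi.smul_apply, smul_eq_mul, RingHom.id_apply]
        rw [map_smul, ismul, map_smul, Pi.smul_apply]; simp only [smul_eq_mul]
        ring }
  have C : ∀ c, c ≠ 0 → ContDiff ℝ 1 (L' c) ∧
      qf f (fun x => max (2 * (d' ^ 2 + 2 * m * d' - G x ^ 2 - 2 * f x * G x) - V x) 0)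
        m d a b (L' c) < 0 := by
    intro c hc
    exact commute hab hd hdd hf hf' hneg hm hV hG hR ha hb (fun x => exp_pos _) hu' (hL (j c))
      (hLq _ (hjinj c hc)) (fun x => rfl) (hj0 c)
  refine ⟨L', fun c => ?_, fun c hc => (C c hc).2⟩
  by_cases hc : c = 0
  · rw [hc, map_zero]; exact contDiff_const
  · exact (C c hc).1

theorem T {f f' : ℝ → ℝ} {m a b : ℝ} (hab : a ≤ b)
    (hf : ∀ x, HasDerivAt f (f' x) x) (hf' : Continuous f') (hneg : ∀ x, f' x ≤ 0)
    (hm : ∀ x, |f x| ≤ m) : ∀ (N : ℕ) (V : ℝ → ℝ) (d : Fin N → ℝ), Continuous V →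
    (∀ k, 0 ≤ d k) → (∀ k, NegD f V m (d k) a b (k + 1)) →
    ∑ k, d k ^ 3 ≤ 3 / 16 * ∫ x in a..b, V x ^ 2 := by
  have hfc : Continuous f := continuous_iff_continuousAt.2 fun x => (hf x).continuousAt
  have hm0 : 0 ≤ m := (abs_nonneg _).trans (hm 0)
  intro N
  induction N with
  | zero =>
    intro V d _ _ _
    have : 0 ≤ ∫ x in a..b, V x ^ 2 :=
      intervalIntegral.integral_nonneg hab (fun x _ => sq_nonneg _)
    simp; linarith
  | succ N ih =>
    intro V d hV hd hN
    obtain ⟨k₀, -, hk₀⟩ := Finset.exists_max_image Finset.univ d ⟨0, Finset.mem_univ _⟩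
    have ex : ∀ k, ∃ ψ : ℝ → ℝ, ContDiff ℝ 1 ψ ∧ qf f V m (d k) a b ψ < 0 := by
      intro k
      obtain ⟨L, h1, h2⟩ := hN k
      exact ⟨L (fun _ => 1), h1 _, h2 _ (fun h => one_ne_zero (congrFun h 0))⟩
    obtain ⟨ψ, hψ, hq⟩ := ex k₀
    obtain ⟨d', G, hdd, hG, hR, ha, hb⟩ := ground hfc hV hab hm0 (hd k₀) hψ hq
    have hlt : ∀ k, d k < d' := by
      intro k
      refine lt_of_le_of_ne ((hk₀ k (Finset.mem_univ _)).trans hdd) fun e => ?_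
      obtain ⟨ψ, hψ, hq⟩ := ex k
      rw [e, qf_eq hab hfc hV hG hψ hR, ha, hb] at hq
      have : 0 ≤ ∫ x in a..b, (deriv ψ x - (f x + G x) * ψ x) ^ 2 :=
        intervalIntegral.integral_nonneg hab (fun x _ => sq_nonneg _)
      linarith
    have g := gain hab hf hf' hneg hm hV hG hR ha hb
    have i := ih _ (fun k => d k.succ) (by fun_prop) (fun k => hd _) (fun k =>
      NegD_step hab (hd k.succ) (hlt _) hf hf' hneg hm hV hG hR ha hb (by simpa using hN k.succ))
    rw [Fin.sum_univ_succ]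
    have : d 0 ^ 3 ≤ d' ^ 3 := pow_le_pow_left₀ (hd 0) (hlt 0).le 3
    linarith
end LTaux

namespace LTaux

def AC (h h' : ℝ → ℝ) : Prop :=
  ∀ a b : ℝ, IntervalIntegrable h' volume a b ∧ ∫ x in a..b, h' x = h b - h a

lemma AC.aci {h h' : ℝ → ℝ} (H : AC h h') (a b : ℝ) : AbsolutelyContinuousOnInterval h a b := by
  have h1 := (H a b).1.absolutelyContinuousOnInterval_intervalIntegral (left_mem_uIcc)
  have h2 : AbsolutelyContinuousOnInterval (fun _ : ℝ => h a) a b :=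
    (contDiff_const.contDiffOn : ContDiffOn ℝ 1 _ _).absolutelyContinuousOnInterval
  have h3 := h1.add h2
  have e : h = ((fun x => ∫ v in a..x, h' v) + fun _ : ℝ => h a) := by
    ext x
    rw [Pi.add_apply, (H a x).2]; ring
  rw [e]; exact h3

lemma AC.continuous {h h' : ℝ → ℝ} (H : AC h h') : Continuous h := by
  have : h = fun x => h 0 + ∫ t in (0:ℝ)..x, h' t := by
    ext x; rw [(H 0 x).2]; ring
  rw [this]
  exact continuous_const.add (intervalIntegral.continuous_primitive (fun a b => (H a b).1) 0)

lemma AC.locInt {h h' : ℝ → ℝ} (H : AC h h') : LocallyIntegrable h' volume := by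
  intro x
  refine ⟨Ioc (x - 1) (x + 1), Ioc_mem_nhds (by linarith) (by linarith), ?_⟩
  exact (intervalIntegrable_iff_integrableOn_Ioc_of_le (by linarith)).1 (H _ _).1

lemma AC.ae_deriv {h h' : ℝ → ℝ} (H : AC h h') : ∀ᵐ x, HasDerivAt h (h' x) x := by
  filter_upwards [LocallyIntegrable.ae_hasDerivAt_integral H.locInt] with x hx
  have := (hx 0).const_add (h 0)
  refine this.congr_of_eventuallyEq (Eventually.of_forall fun y => ?_)
  simp only []
  rw [(H 0 y).2]; ring

lemma AC.congr_ae {h h' k' : ℝ → ℝ} (H : AC h h') (e : ∀ᵐ x, h' x = k' x) : AC h k' := by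
  intro a b
  have e' : h' =ᵐ[volume] k' := e
  refine ⟨(H a b).1.congr_ae (ae_restrict_of_ae e'), ?_⟩
  rw [← (H a b).2]
  exact (intervalIntegral.integral_congr_ae (by filter_upwards [e] with x hx _; exact hx)).symm

lemma AC.mul {h h' g g' : ℝ → ℝ} (H : AC h h') (K : AC g g') :
    AC (fun x => h x * g x) (fun x => h' x * g x + h x * g' x) := by
  intro a b
  refine ⟨((H a b).1.mul_continuousOn K.continuous.continuousOn).add
    ((K a b).1.continuousOn_mul H.continuous.continuousOn), ?_⟩
  rw [← (H.aci a b).integral_deriv_mul_eq_sub (K.aci a b)]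
  apply intervalIntegral.integral_congr_ae
  filter_upwards [H.ae_deriv, K.ae_deriv] with x h1 h2 _
  rw [h1.deriv, h2.deriv]

lemma AC.of_deriv {h h' : ℝ → ℝ} (hd : ∀ x, HasDerivAt h (h' x) x) (hc : Continuous h') : AC h h' :=
  fun _ _ => ⟨hc.intervalIntegrable _ _, intervalIntegral.integral_eq_sub_of_hasDerivAt
    (fun x _ => hd x) (hc.intervalIntegrable _ _)⟩

lemma AC.add {h h' g g' : ℝ → ℝ} (H : AC h h') (K : AC g g') :
    AC (fun x => h x + g x) (fun x => h' x + g' x) := fun a b =>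
  ⟨(H a b).1.add (K a b).1, by
    rw [intervalIntegral.integral_add (H a b).1 (K a b).1, (H a b).2, (K a b).2]; ring⟩

lemma AC.const_mul {h h' : ℝ → ℝ} (H : AC h h') (c : ℝ) :
    AC (fun x => c * h x) (fun x => c * h' x) := fun a b =>
  ⟨(H a b).1.const_mul c, by
    rw [intervalIntegral.integral_const_mul, (H a b).2]; ring⟩

lemma AC.refl {h h' : ℝ → ℝ} (H : AC h h') : AC (fun x => -h (-x)) (fun x => h' (-x)) := fun a b => by
  refine ⟨(IntervalIntegrable.iff_comp_neg (by simp)).2 (by simpa using (H (-a) (-b)).1), ?_⟩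
  rw [intervalIntegral.integral_comp_neg, (H _ _).2]; ring

lemma AC.mono {h h' : ℝ → ℝ} (H : AC h h') {a b : ℝ} (hab : a ≤ b)
    (hp : ∀ᵐ x, a ≤ x → 0 ≤ h' x) : h a ≤ h b := by
  have : 0 ≤ ∫ x in a..b, h' x := by
    rw [intervalIntegral.integral_of_le hab]
    apply setIntegral_nonneg_of_ae_restrict
    filter_upwards [ae_restrict_of_ae hp, ae_restrict_mem measurableSet_Ioc] with x hx hm
    exact hx hm.1.le
  rw [(H a b).2] at this; linarith

lemma AC.anti {h h' : ℝ → ℝ} (H : AC h h') {a b : ℝ} (hab : a ≤ b)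
    (hp : ∀ᵐ x, a ≤ x → h' x ≤ 0) : h b ≤ h a := by
  have := (H.const_mul (-1)).mono hab (by filter_upwards [hp] with x hx h; linarith [hx h])
  linarith

lemma not_L2 {φ : ℝ → ℝ} (h : MemLp φ 2 volume) {X η : ℝ} (hη : 0 < η)
    (hb : ∀ x, X ≤ x → η ≤ φ x) : False := by
  have h1 : Integrable (fun x => φ x ^ 2) := h.integrable_sq
  have h2 : IntegrableOn (fun _ : ℝ => η ^ 2) (Ici X) := by
    refine Integrable.mono' h1.integrableOn (by fun_prop) ?_
    filter_upwards [ae_restrict_mem measurableSet_Ici] with x hx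
    rw [Real.norm_eq_abs, abs_of_pos (by positivity)]
    exact pow_le_pow_left₀ hη.le (hb x hx) 2
  rw [integrableOn_const_iff] at h2
  rcases h2 with h2 | h2
  · have : η ^ 2 ≠ 0 := by positivity
    simp at h2; exact this (by simp [h2])
  · simp at h2

structure Pos (p φ φ'' : ℝ → ℝ) : Prop where
  pos : ∀ x, 0 < φ x
  l2 : MemLp φ 2 (volume : Measure ℝ)
  c1 : ContDiff ℝ 1 φ
  ac : AC (deriv φ) φ''
  eq : ∀ᵐ x, φ'' x = p x * φ x

lemma deriv_refl {φ : ℝ → ℝ} : deriv (fun x => φ (-x)) = fun x => - deriv φ (-x) := by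
  ext x; exact deriv_comp_neg φ x

lemma ae_neg {P : ℝ → Prop} (h : ∀ᵐ x : ℝ, P x) : ∀ᵐ x : ℝ, P (-x) :=
  (Measure.measurePreserving_neg (volume : Measure ℝ)).quasiMeasurePreserving.ae h

lemma Pos.refl {p φ φ'' : ℝ → ℝ} (H : Pos p φ φ'') :
    Pos (fun x => p (-x)) (fun x => φ (-x)) (fun x => φ'' (-x)) where
  pos := fun x => H.pos _
  l2 := H.l2.comp_measurePreserving (Measure.measurePreserving_neg (volume : Measure ℝ))
  c1 := H.c1.comp contDiff_neg
  ac := by rw [deriv_refl]; exact H.ac.refl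
  eq := ae_neg H.eq

lemma Pos.expY {p φ φ'' : ℝ → ℝ} (H : Pos p φ φ'') (s : ℝ) :
    AC (fun x => exp (-s * x) * (deriv φ x + s * φ x))
      (fun x => exp (-s * x) * ((p x - s ^ 2) * φ x)) := by
  obtain ⟨h1, h2, h3⟩ := LTaux.c1 H.c1
  have e : AC (fun x => exp (-s * x)) (fun x => -s * exp (-s * x)) := by
    apply AC.of_deriv _ (by fun_prop)
    intro x
    have := ((hasDerivAt_id x).const_mul (-s)).exp
    exact this.congr_deriv (by simp; ring)
  have := e.mul (H.ac.add ((AC.of_deriv h3 h2).const_mul s))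
  refine this.congr_ae ?_
  filter_upwards [H.eq] with x hx
  rw [hx]; ring

lemma Pos.rightA {p φ φ'' : ℝ → ℝ} (H : Pos p φ φ'') {c : ℝ} (hp : MonotoneOn p (Ici c)) {x₀ : ℝ}
    (hx₀ : c ≤ x₀) : p x₀ ≤ (deriv φ x₀ / φ x₀) ^ 2 := by
  by_contra! hcon
  obtain ⟨h1, h2, h3⟩ := LTaux.c1 H.c1
  have hp0 : 0 < p x₀ := lt_of_le_of_lt (sq_nonneg _) hcon
  set s := √(p x₀)
  have hs : 0 < s := sqrt_pos.2 hp0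
  have hs2 : s ^ 2 = p x₀ := sq_sqrt hp0.le
  have hφ := H.pos x₀
  have hlt : 0 < deriv φ x₀ + s * φ x₀ := by
    have : -s < deriv φ x₀ / φ x₀ := by
      rw [← hs2] at hcon
      exact (abs_lt_of_sq_lt_sq' hcon hs.le).1
    rw [lt_div_iff₀ hφ] at this; linarith
  set η := deriv φ x₀ + s * φ x₀ with hη
  have hY : ∀ x, x₀ ≤ x → η ≤ deriv φ x + s * φ x := by
    intro x hx
    have := (H.expY s).mono hx (by
      refine Eventually.of_forall fun y hy => ?_
      have : p x₀ ≤ p y := hp hx₀ (hx₀.trans hy) hy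
      rw [hs2]
      have := H.pos y
      have := exp_pos (-s * y)
      apply mul_nonneg this.le (mul_nonneg (by linarith) (by linarith)))
    have e : exp (-s * x) ≤ exp (-s * x₀) := exp_le_exp.2 (by nlinarith)
    have : exp (-s * x) * η ≤ exp (-s * x) * (deriv φ x + s * φ x) :=
      (mul_le_mul_of_nonneg_right e hlt.le).trans this
    exact le_of_mul_le_mul_left this (exp_pos _)
  have hZ : AC (fun x => exp (s * x) * (φ x - η / s))
      (fun x => exp (s * x) * (deriv φ x + s * φ x - η)) := by
    apply AC.of_deriv _ (by fun_prop)
    intro x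
    have := (((hasDerivAt_id x).const_mul s).exp).mul ((h3 x).sub_const (η / s))
    exact this.congr_deriv (by simp; field_simp; ring)
  apply not_L2 H.l2 (X := x₀ + 1 / s) (η := η / s / 2) (by positivity)
  intro x hx
  have hx0 : x₀ ≤ x := by have : 0 < 1 / s := by positivity
                          linarith
  have h4 := hZ.mono hx0 (Eventually.of_forall fun y hy => by
    have := hY y hy
    exact mul_nonneg (exp_pos _).le (by linarith))
  have e1 : exp (s * x₀) * 2 ≤ exp (s * x) := by
    have : s * x = s * x₀ + s * (x - x₀) := by ring
    rw [this, exp_add]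
    apply mul_le_mul_of_nonneg_left _ (exp_pos _).le
    have h5 : 1 ≤ s * (x - x₀) := by
      have : 1 / s ≤ x - x₀ := by linarith
      rwa [div_le_iff₀' hs] at this
    linarith [add_one_le_exp (s * (x - x₀))]
  have q : 0 < η / s := by positivity
  have e0 := exp_pos (s * x₀)
  have h6 : exp (s * x) * (η / s / 2) ≤ exp (s * x) * φ x := by
    nlinarith
  exact le_of_mul_le_mul_left h6 (exp_pos _)

lemma Pos.rightB {p φ φ'' : ℝ → ℝ} (H : Pos p φ φ'') {m : ℝ} (hm : 0 ≤ m) (hp : ∀ x, p x ≤ m ^ 2)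
    (x₀ : ℝ) : -m ≤ deriv φ x₀ / φ x₀ := by
  by_contra! hcon
  obtain ⟨h1, h2, h3⟩ := LTaux.c1 H.c1
  rw [div_lt_iff₀ (H.pos x₀)] at hcon
  set η := -(deriv φ x₀ + m * φ x₀) with hη
  have hηp : 0 < η := by linarith
  have hZ : ∀ x, x₀ ≤ x → deriv φ x ≤ -η := by
    intro x hx
    have := (H.expY m).anti hx (by
      refine Eventually.of_forall fun y hy => ?_
      have h1 := hp y
      have h2 := H.pos y
      apply mul_nonpos_of_nonneg_of_nonpos (exp_pos _).le
      apply mul_nonpos_of_nonpos_of_nonneg (by linarith) h2.le)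
    have e : exp (-m * x) ≤ exp (-m * x₀) := exp_le_exp.2 (by nlinarith)
    have h5 : exp (-m * x) * (deriv φ x + m * φ x) ≤ exp (-m * x) * (-η) := by
      have : exp (-m * x₀) * (-η) ≤ exp (-m * x) * (-η) := by nlinarith
      have e2 : deriv φ x₀ + m * φ x₀ = -η := by ring
      rw [e2] at *
      linarith
    have h6 := le_of_mul_le_mul_left h5 (exp_pos _)
    nlinarith [mul_nonneg hm (H.pos x).le]
  set x := x₀ + φ x₀ / η
  have hx : x₀ ≤ x := by
    have : 0 < φ x₀ / η := div_pos (H.pos _) hηp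
    simp only [x]; linarith
  have := ((AC.of_deriv h3 h2).add (AC.of_deriv (h := fun x => η * x) (h' := fun _ => η)
    (fun x => ((hasDerivAt_id x).const_mul η).congr_deriv (by simp)) continuous_const)).anti hx
    (Eventually.of_forall fun y hy => by linarith [hZ y hy])
  have e : η * x = η * x₀ + φ x₀ := by simp only [x]; field_simp
  linarith [H.pos x]

lemma Pos.F {V₀ φ φ'' : ℝ → ℝ} {m c : ℝ} (hm : 0 ≤ m) (H : Pos (fun x => m ^ 2 - V₀ x) φ φ'')
    (hV : ∀ x, 0 ≤ V₀ x) (hl : MonotoneOn V₀ (Iic c)) (hr : AntitoneOn V₀ (Ici c)) :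
    ∃ F : ℝ → ℝ, AC F (fun x => m ^ 2 - V₀ x - F x ^ 2) ∧ Antitone F ∧ ∀ x, |F x| ≤ m := by
  obtain ⟨h1, h2, h3⟩ := LTaux.c1 H.c1
  have hne : ∀ x, φ x ≠ 0 := fun x => (H.pos x).ne'
  have hAC : AC (fun x => deriv φ x / φ x)
      (fun x => m ^ 2 - V₀ x - (deriv φ x / φ x) ^ 2) := by
    have hi : AC (fun x => (φ x)⁻¹) (fun x => - deriv φ x / φ x ^ 2) :=
      AC.of_deriv (fun x => (h3 x).inv (hne x))
        (by have : ∀ x, φ x ^ 2 ≠ 0 := fun x => pow_ne_zero 2 (hne x)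
            fun_prop (disch := assumption))
    have := H.ac.mul hi
    refine AC.congr_ae (h := fun x => deriv φ x / φ x) this ?_
    filter_upwards [H.eq] with x hx
    have := hne x
    rw [hx]; field_simp
    ring
  have dr := fun x => congrFun (deriv_refl (φ := φ)) x
  refine ⟨_, hAC, ?_, fun x => abs_le.2 ⟨?_, ?_⟩⟩
  · intro x y hxy
    refine hAC.anti hxy (Eventually.of_forall fun z _ => ?_)
    rcases le_total c z with hz | hz
    · have := H.rightA (c := c) (fun s hs t ht hst => by
        have := hr hs ht hst
        simp only []; linarith) hz
      linarith
    · have := H.refl.rightA (c := -c) (x₀ := -z) (fun s hs t ht hst => by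
        have hs' : -c ≤ s := hs
        have ht' : -c ≤ t := ht
        have := hl (show -t ∈ Iic c by simp; linarith) (show -s ∈ Iic c by simp; linarith)
          (by linarith)
        simp only []; linarith) (by linarith)
      rw [dr] at this
      simp only [neg_neg, neg_div, neg_sq] at this
      linarith
  · exact H.rightB hm (fun x => by linarith [hV x]) x
  · have := H.refl.rightB hm (fun x => by linarith [hV (-x)]) (-x)
    rw [dr] at this
    simp only [neg_neg, neg_div] at this
    linarith
end LTaux

namespace LTaux

structure Eig (V₀ V : ℝ → ℝ) (l : ℝ) (ψ ψ'' : ℝ → ℝ) : Prop where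
  l2 : MemLp ψ 2 (volume : Measure ℝ)
  c1 : ContDiff ℝ 1 ψ
  ac : AC (deriv ψ) ψ''
  eq : ∀ᵐ x, ψ'' x = (l - V₀ x - V x) * ψ x

lemma Eig.refl {V₀ V ψ ψ'' : ℝ → ℝ} {l : ℝ} (H : Eig V₀ V l ψ ψ'') :
    Eig (fun x => V₀ (-x)) (fun x => V (-x)) l (fun x => ψ (-x)) (fun x => ψ'' (-x)) where
  l2 := H.l2.comp_measurePreserving (Measure.measurePreserving_neg (volume : Measure ℝ))
  c1 := H.c1.comp contDiff_neg
  ac := by rw [deriv_refl]; exact H.ac.refl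
  eq := ae_neg H.eq

lemma setInt_le {g : ℝ → ℝ} (hg : Integrable g) (h0 : ∀ x, 0 ≤ g x) {a b : ℝ} (hab : a ≤ b) :
    ∫ x in a..b, g x ≤ ∫ x, g x := by
  rw [intervalIntegral.integral_of_le hab]
  exact setIntegral_le_integral hg (Eventually.of_forall h0)

lemma Eig.bound {V₀ V ψ ψ'' : ℝ → ℝ} {l B : ℝ} (H : Eig V₀ V l ψ ψ'') (hl : 0 ≤ l)
    (hB : ∀ x, V₀ x ≤ B) (hB0 : 0 ≤ B) (hV : MemLp (fun x => max (V x) 0) 2 (volume : Measure ℝ)) :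
    ∃ C, ∀ b, 0 ≤ b → (∫ x in (0:ℝ)..b, deriv ψ x ^ 2) / 2 ≤ ψ b * deriv ψ b + C := by
  obtain ⟨h1, h2, h3⟩ := LTaux.c1 H.c1
  set P := ∫ x, ψ x ^ 2
  set A := ∫ x, (max (V x) 0) ^ 2
  have hP : 0 ≤ P := integral_nonneg fun x => sq_nonneg _
  have i1 : Integrable (fun x => ψ x ^ 2) := H.l2.integrable_sq
  have i2 : Integrable (fun x => (max (V x) 0) ^ 2) := hV.integrable_sq
  refine ⟨-(ψ 0 * deriv ψ 0) + B * P + A / 2 + (ψ 0 ^ 2 + (P + 1) * P) * P / 2, fun b hb => ?_⟩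
  set I := ∫ x in (0:ℝ)..b, deriv ψ x ^ 2 with hI
  have hI0 : 0 ≤ I := intervalIntegral.integral_nonneg hb fun x _ => sq_nonneg _
  have ci : ∀ {g : ℝ → ℝ}, Continuous g → ∀ a b, IntervalIntegrable g volume a b :=
    fun hg a b => hg.intervalIntegrable a b
  have sup : ∀ x ∈ Icc 0 b, ψ x ^ 2 ≤ ψ 0 ^ 2 + (P + 1) * P + I / (P + 1) := by
    intro x hx
    have e1 := ftc (g := fun x => ψ x ^ 2) (g' := fun x => 2 * ψ x * deriv ψ x) hx.1 (by fun_prop)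
      (by fun_prop) (fun y _ => ((h3 y).pow 2).congr_deriv (by simp))
    have e2 : ∫ y in (0:ℝ)..x, 2 * ψ y * deriv ψ y ≤
        ∫ y in (0:ℝ)..x, ((P + 1) * ψ y ^ 2 + (P + 1)⁻¹ * deriv ψ y ^ 2) := by
      apply intervalIntegral.integral_mono_on hx.1 (ci (by fun_prop) _ _) (ci (by fun_prop) _ _)
      intro y _
      have hp : 0 < P + 1 := by linarith
      have : (P + 1) * ψ y ^ 2 + (P + 1)⁻¹ * deriv ψ y ^ 2 - 2 * ψ y * deriv ψ y
        = (P + 1)⁻¹ * ((P + 1) * ψ y - deriv ψ y) ^ 2 := by field_simp; ring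
      have h5 : 0 ≤ (P + 1)⁻¹ * ((P + 1) * ψ y - deriv ψ y) ^ 2 := by positivity
      linarith
    rw [intervalIntegral.integral_add (ci (by fun_prop) _ _) (ci (by fun_prop) _ _),
      intervalIntegral.integral_const_mul, intervalIntegral.integral_const_mul] at e2
    have e3 : ∫ y in (0:ℝ)..x, ψ y ^ 2 ≤ P := setInt_le i1 (fun _ => sq_nonneg _) hx.1
    have e4 : ∫ y in (0:ℝ)..x, deriv ψ y ^ 2 ≤ I := by
      have := intervalIntegral.integral_add_adjacent_intervals
        (ci (g := fun y => deriv ψ y ^ 2) (by fun_prop) 0 x) (ci (by fun_prop) x b)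
      have h6 : 0 ≤ ∫ y in x..b, deriv ψ y ^ 2 :=
        intervalIntegral.integral_nonneg hx.2 fun x _ => sq_nonneg _
      linarith
    have hp : 0 < P + 1 := by linarith
    have e5 := mul_le_mul_of_nonneg_left e3 hp.le
    have e6 := mul_le_mul_of_nonneg_left e4 (inv_pos.2 hp).le
    rw [div_eq_inv_mul]
    linarith
  set S := ψ 0 ^ 2 + (P + 1) * P + I / (P + 1) with hS
  have hS0 : 0 ≤ S := by positivity
  have fin := (((AC.of_deriv h3 h2).mul H.ac) 0 b)
  have e7 : ∫ x in (0:ℝ)..b, (deriv ψ x ^ 2 - B * ψ x ^ 2 - (max (V x) 0) ^ 2 / 2 - S / 2 * ψ x ^ 2)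
      ≤ ∫ x in (0:ℝ)..b, (deriv ψ x * deriv ψ x + ψ x * ψ'' x) := by
    apply intervalIntegral.integral_mono_ae_restrict hb
    · exact (((ci (by fun_prop) _ _).sub (ci (by fun_prop) _ _)).sub
        ((i2.intervalIntegrable).div_const 2)).sub (ci (by fun_prop) _ _)
    · exact fin.1
    · filter_upwards [ae_restrict_of_ae H.eq, ae_restrict_mem measurableSet_Icc] with x hx hxm
      have s1 := sup x hxm
      have s2 := hB x
      have s3 := le_max_left (V x) 0
      set U := max (V x) 0
      rw [hx]
      have t : 0 ≤ ψ x ^ 2 := sq_nonneg _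
      have a1 : V₀ x * ψ x ^ 2 ≤ B * ψ x ^ 2 := mul_le_mul_of_nonneg_right s2 t
      have a2 : V x * ψ x ^ 2 ≤ U * ψ x ^ 2 := mul_le_mul_of_nonneg_right s3 t
      have a3 : ψ x ^ 2 * ψ x ^ 2 ≤ S * ψ x ^ 2 := mul_le_mul_of_nonneg_right s1 t
      have a4 := sq_nonneg (U - ψ x ^ 2)
      have a5 : 0 ≤ l * ψ x ^ 2 := mul_nonneg hl t
      nlinarith
  rw [fin.2, intervalIntegral.integral_sub, intervalIntegral.integral_sub,
    intervalIntegral.integral_sub, intervalIntegral.integral_const_mul,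
    intervalIntegral.integral_const_mul, intervalIntegral.integral_div] at e7
  rotate_left
  · exact (ci (by fun_prop) _ _)
  · exact (ci (by fun_prop) _ _)
  · exact ((ci (by fun_prop) _ _).sub (ci (by fun_prop) _ _))
  · exact ((i2.intervalIntegrable).div_const 2)
  · exact (((ci (by fun_prop) _ _).sub (ci (by fun_prop) _ _)).sub
        ((i2.intervalIntegrable).div_const 2))
  · exact (ci (by fun_prop) _ _)
  have e8 : ∫ y in (0:ℝ)..b, ψ y ^ 2 ≤ P := setInt_le i1 (fun _ => sq_nonneg _) hb
  have e9 : ∫ y in (0:ℝ)..b, (max (V y) 0) ^ 2 ≤ A := setInt_le i2 (fun _ => sq_nonneg _) hb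
  have f1 := mul_le_mul_of_nonneg_left e8 hB0
  have f2 := mul_le_mul_of_nonneg_left e8 (by positivity : 0 ≤ S / 2)
  have f3 : S / 2 * P ≤ (ψ 0 ^ 2 + (P + 1) * P) * P / 2 + I / 2 := by
    have : I / (P + 1) * P ≤ I := by
      rw [div_mul_eq_mul_div, div_le_iff₀ (by linarith)]; nlinarith
    rw [hS]; nlinarith
  linarith

lemma Eig.intR {V₀ V ψ ψ'' : ℝ → ℝ} {l B : ℝ} (H : Eig V₀ V l ψ ψ'') (hl : 0 ≤ l)
    (hB : ∀ x, V₀ x ≤ B) (hB0 : 0 ≤ B) (hV : MemLp (fun x => max (V x) 0) 2 (volume : Measure ℝ)) :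
    IntegrableOn (fun x => ψ x ^ 2 + deriv ψ x ^ 2) (Ioi 0) := by
  obtain ⟨h1, h2, h3⟩ := LTaux.c1 H.c1
  have i1 : Integrable (fun x => ψ x ^ 2) := H.l2.integrable_sq
  obtain ⟨C, hC⟩ := H.bound hl hB hB0 hV
  refine i1.integrableOn.add ?_
  have bd : ∀ b, 0 ≤ b → ∫ x in (0:ℝ)..b, deriv ψ x ^ 2 ≤ 2 * (C + 1) := by
    intro b₀ hb₀
    by_contra! hcon
    have hge : ∀ b, b₀ ≤ b → 1 ≤ ψ b * deriv ψ b := by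
      intro b hb
      have e1 := hC b (hb₀.trans hb)
      have := intervalIntegral.integral_add_adjacent_intervals
        (μ := volume) (f := fun y => deriv ψ y ^ 2) (a := 0) (b := b₀) (c := b)
        ((by fun_prop : Continuous fun y => deriv ψ y ^ 2).intervalIntegrable _ _)
        ((by fun_prop : Continuous fun y => deriv ψ y ^ 2).intervalIntegrable _ _)
      have h6 : 0 ≤ ∫ y in b₀..b, deriv ψ y ^ 2 :=
        intervalIntegral.integral_nonneg hb fun x _ => sq_nonneg _
      linarith
    have hL : MemLp (fun x => |ψ x|) 2 volume := H.l2.norm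
    refine not_L2 hL (X := b₀ + 1) (η := 1) one_pos fun x hx => ?_
    have := (AC.of_deriv (h := fun x => ψ x ^ 2 - 2 * x) (h' := fun x => 2 * (ψ x * deriv ψ x) - 2)
      (fun x => ((((h3 x).pow 2)).sub ((hasDerivAt_id x).const_mul 2)).congr_deriv (by simp; ring))
      (by fun_prop)).mono (a := b₀) (b := x) (by linarith)
      (Eventually.of_forall fun y hy => by linarith [hge y hy])
    rw [← abs_one, ← sq_le_sq]
    nlinarith [sq_nonneg (ψ b₀)]
  refine integrableOn_Ioi_of_intervalIntegral_norm_bounded (l := atTop) (b := fun x : ℝ => x)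
    (2 * (C + 1)) 0 (fun x => ?_) tendsto_id ?_
  · exact ((by fun_prop : Continuous fun y => deriv ψ y ^ 2).intervalIntegrable 0 x).1
  · filter_upwards [eventually_ge_atTop 0] with b hb
    simpa using bd b hb

lemma small_of_int {H : ℝ → ℝ} (hH : IntegrableOn H (Ioi 0)) {ε : ℝ}
    (hε : 0 < ε) (X : ℝ) : ∃ b, X ≤ b ∧ H b < ε := by
  by_contra! hcon
  have h2 : IntegrableOn (fun _ : ℝ => ε) (Ioi (max X 0)) := by
    refine Integrable.mono' (hH.mono_set (Ioi_subset_Ioi (le_max_right _ _))) (by fun_prop) ?_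
    filter_upwards [ae_restrict_mem measurableSet_Ioi] with x hx
    rw [Real.norm_eq_abs, abs_of_pos hε]
    exact hcon x (le_of_lt (lt_of_le_of_lt (le_max_left _ _) hx))
  rw [integrableOn_const_iff] at h2
  rcases h2 with h2 | h2
  · simp at h2; exact hε.ne' h2
  · simp at h2

lemma small_seq {ι : Type*} [Fintype ι] {ψ : ι → ℝ → ℝ}
    (h : ∀ i, IntegrableOn (fun x => ψ i x ^ 2 + deriv (ψ i) x ^ 2) (Ioi 0)) :
    ∃ b : ℕ → ℝ, Tendsto b atTop atTop ∧ ∀ i, Tendsto (fun n => ψ i (b n)) atTop (𝓝 0) ∧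
      Tendsto (fun n => deriv (ψ i) (b n)) atTop (𝓝 0) := by
  have hs : IntegrableOn (fun x => ∑ i, (ψ i x ^ 2 + deriv (ψ i) x ^ 2)) (Ioi 0) :=
    integrable_finsetSum _ fun i _ => h i
  choose b hb1 hb2 using fun n : ℕ => small_of_int hs (ε := 1 / ((n : ℝ) + 1)) (by positivity) n
  have lim := tendsto_one_div_add_atTop_nhds_zero_nat (𝕜 := ℝ)
  have key : ∀ i n, ψ i (b n) ^ 2 + deriv (ψ i) (b n) ^ 2 ≤ 1 / ((n : ℝ) + 1) := fun i n =>
    (Finset.single_le_sum (f := fun i => ψ i (b n) ^ 2 + deriv (ψ i) (b n) ^ 2)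
      (fun i _ => by positivity) (Finset.mem_univ i)).trans (hb2 n).le
  have sq0 : ∀ {g : ℕ → ℝ}, Tendsto (fun n => g n ^ 2) atTop (𝓝 0) → Tendsto g atTop (𝓝 0) := by
    intro g hg
    have := hg.sqrt
    simp only [sqrt_sq_eq_abs, sqrt_zero] at this
    exact (tendsto_zero_iff_abs_tendsto_zero g).2 this
  refine ⟨b, tendsto_atTop_mono hb1 tendsto_natCast_atTop_atTop, fun i => ⟨sq0 ?_, sq0 ?_⟩⟩
  · exact squeeze_zero (fun n => sq_nonneg _) (fun n => by
      have := key i n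
      nlinarith [sq_nonneg (deriv (ψ i) (b n))]) lim
  · exact squeeze_zero (fun n => sq_nonneg _) (fun n => by
      have := key i n
      nlinarith [sq_nonneg (ψ i (b n))]) lim

lemma two_seq {ι : Type*} [Fintype ι] {V₀ V : ℝ → ℝ} {l : ι → ℝ} {B : ℝ} {ψ ψ'' : ι → ℝ → ℝ}
    (H : ∀ i, Eig V₀ V (l i) (ψ i) (ψ'' i)) (hl : ∀ i, 0 ≤ l i)
    (hB : ∀ x, V₀ x ≤ B) (hB0 : 0 ≤ B) (hV : MemLp (fun x => max (V x) 0) 2 (volume : Measure ℝ)) :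
    ∃ a b : ℕ → ℝ, Tendsto a atTop atBot ∧ Tendsto b atTop atTop ∧ ∀ i,
      Tendsto (fun n => ψ i (a n)) atTop (𝓝 0) ∧
      Tendsto (fun n => deriv (ψ i) (a n)) atTop (𝓝 0) ∧
      Tendsto (fun n => ψ i (b n)) atTop (𝓝 0) ∧
      Tendsto (fun n => deriv (ψ i) (b n)) atTop (𝓝 0) := by
  obtain ⟨b, hb1, hb2⟩ := small_seq (fun i => (H i).intR (hl i) hB hB0 hV)
  have hV' : MemLp (fun x => max (V (-x)) 0) 2 (volume : Measure ℝ) :=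
    hV.comp_measurePreserving (Measure.measurePreserving_neg (volume : Measure ℝ))
  obtain ⟨a, ha1, ha2⟩ := small_seq (fun i => (H i).refl.intR (hl i) (fun x => hB _) hB0 hV')
  refine ⟨fun n => -a n, b, tendsto_neg_atTop_atBot.comp ha1, hb1, fun i =>
    ⟨(ha2 i).1, ?_, (hb2 i).1, (hb2 i).2⟩⟩
  have := (ha2 i).2.neg
  rw [deriv_refl] at this
  simpa using this
end LTaux

namespace LTaux

lemma formEst {V₀ V F U ψ ψ'' η : ℝ → ℝ} {m d a b : ℝ} (hab : a ≤ b)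
    (hF : AC F (fun x => m ^ 2 - V₀ x - F x ^ 2)) (hU : ∀ x, V x ≤ U x)
    (hUi : IntervalIntegrable U volume a b)
    (hψ : ContDiff ℝ 1 ψ) (ac : AC (deriv ψ) ψ'') (hη : Continuous η)
    (eq : ∀ᵐ x, ψ'' x = η x - (V₀ x + V x) * ψ x) :
    qf F U m d a b ψ ≤ (ψ b * deriv ψ b - F b * (ψ b * ψ b)) - (ψ a * deriv ψ a - F a * (ψ a * ψ a))
      + (∫ x in a..b, ((m + d) ^ 2 * ψ x - η x) * ψ x) + d * (ψ a ^ 2 + ψ b ^ 2) := by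
  obtain ⟨h1, h2, h3⟩ := LTaux.c1 hψ
  have hFc := hF.continuous
  have hd := AC.of_deriv h3 h2
  have K := ((hd.mul ac).add ((hF.mul (hd.mul hd)).const_mul (-1))) a b
  have i2 : IntervalIntegrable (fun x => ((m + d) ^ 2 * ψ x - η x) * ψ x) volume a b :=
    (by fun_prop : Continuous fun x => ((m + d) ^ 2 * ψ x - η x) * ψ x).intervalIntegrable _ _
  have e := K.2
  have key : ∫ x in a..b, ((deriv ψ x - F x * ψ x) ^ 2 - U x * ψ x ^ 2
      + (d ^ 2 + 2 * m * d) * ψ x ^ 2) ≤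
      ∫ x in a..b, ((deriv ψ x * deriv ψ x + ψ x * ψ'' x + -1 * ((m ^ 2 - V₀ x - F x ^ 2) * (ψ x * ψ x)
        + F x * (deriv ψ x * ψ x + ψ x * deriv ψ x))) + ((m + d) ^ 2 * ψ x - η x) * ψ x) := by
    apply intervalIntegral.integral_mono_ae_restrict hab
    · refine (IntervalIntegrable.sub ?_ ?_).add ?_
      · exact (by fun_prop : Continuous fun x => (deriv ψ x - F x * ψ x) ^ 2).intervalIntegrable _ _
      · exact hUi.mul_continuousOn (by fun_prop)
      · exact (by fun_prop : Continuous fun x => (d ^ 2 + 2 * m * d) * ψ x ^ 2).intervalIntegrable _ _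
    · exact K.1.add i2
    · filter_upwards [ae_restrict_of_ae eq] with x hx
      rw [hx]
      have := mul_le_mul_of_nonneg_right (hU x) (sq_nonneg (ψ x))
      nlinarith
  rw [intervalIntegral.integral_add K.1 i2, e] at key
  unfold qf
  linarith

noncomputable def R (f U : ℝ → ℝ) (m d a b : ℝ) (α β : ℝ → ℝ) : ℝ :=
  (∫ x in a..b, ((deriv α x - f x * α x) * (deriv β x - f x * β x) - U x * (α x * β x)
    + (d ^ 2 + 2 * m * d) * (α x * β x))) + d * (α a * β a + α b * β b)

lemma deriv_comb {ι : Type*} [Fintype ι] {ψ : ι → ℝ → ℝ} (hψ : ∀ i, ContDiff ℝ 1 (ψ i))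
    (c : ι → ℝ) (x : ℝ) : deriv (fun x => ∑ i, c i * ψ i x) x = ∑ i, c i * deriv (ψ i) x := by
  apply HasDerivAt.deriv
  apply HasDerivAt.fun_sum
  intro i _
  exact ((LTaux.c1 (hψ i)).2.2 x).const_mul (c i)

lemma sq_sum' {ι : Type*} [Fintype ι] (c α β : ι → ℝ) :
    (∑ i, c i * α i) * (∑ i, c i * β i) = ∑ i, ∑ j, c i * c j * (α i * β j) := by
  rw [Finset.sum_mul_sum]
  refine Finset.sum_congr rfl fun i _ => Finset.sum_congr rfl fun j _ => by ring

lemma qf_sum {ι : Type*} [Fintype ι] {ψ : ι → ℝ → ℝ} (hψ : ∀ i, ContDiff ℝ 1 (ψ i))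
    {f U : ℝ → ℝ} {m d a b : ℝ} (hf : Continuous f) (hU : IntervalIntegrable U volume a b)
    (c : ι → ℝ) : qf f U m d a b (fun x => ∑ i, c i * ψ i x)
      = ∑ i, ∑ j, c i * c j * R f U m d a b (ψ i) (ψ j) := by
  have ii : ∀ i j, IntervalIntegrable (fun x => (deriv (ψ i) x - f x * ψ i x) *
      (deriv (ψ j) x - f x * ψ j x) - U x * (ψ i x * ψ j x)
    + (d ^ 2 + 2 * m * d) * (ψ i x * ψ j x)) volume a b := by
    intro i j
    obtain ⟨h1, h2, -⟩ := LTaux.c1 (hψ i)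
    obtain ⟨k1, k2, -⟩ := LTaux.c1 (hψ j)
    refine (IntervalIntegrable.sub ?_ ?_).add ?_
    · exact Continuous.intervalIntegrable (by fun_prop) _ _
    · exact hU.mul_continuousOn (by fun_prop)
    · exact Continuous.intervalIntegrable (by fun_prop) _ _
  unfold qf R
  have e1 : ∫ x in a..b, ((deriv (fun x => ∑ i, c i * ψ i x) x - f x * ∑ i, c i * ψ i x) ^ 2
      - U x * (∑ i, c i * ψ i x) ^ 2 + (d ^ 2 + 2 * m * d) * (∑ i, c i * ψ i x) ^ 2)
      = ∑ i, ∑ j, c i * c j * ∫ x in a..b, ((deriv (ψ i) x - f x * ψ i x) *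
      (deriv (ψ j) x - f x * ψ j x) - U x * (ψ i x * ψ j x)
        + (d ^ 2 + 2 * m * d) * (ψ i x * ψ j x)) := by
    simp_rw [← intervalIntegral.integral_const_mul]
    have s1 : ∀ i, ∑ j, ∫ x in a..b, c i * c j * ((deriv (ψ i) x - f x * ψ i x) *
        (deriv (ψ j) x - f x * ψ j x) - U x * (ψ i x * ψ j x)
        + (d ^ 2 + 2 * m * d) * (ψ i x * ψ j x)) =
        ∫ x in a..b, ∑ j, c i * c j * ((deriv (ψ i) x - f x * ψ i x) *
        (deriv (ψ j) x - f x * ψ j x) - U x * (ψ i x * ψ j x)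
        + (d ^ 2 + 2 * m * d) * (ψ i x * ψ j x)) := fun i =>
      (intervalIntegral.integral_finsetSum fun j _ => (ii i j).const_mul _).symm
    simp_rw [s1]
    rw [← intervalIntegral.integral_finsetSum fun i _ => ?_]
    · congr 1
      ext x
      rw [deriv_comb hψ]
      have e2 : ∑ i, c i * deriv (ψ i) x - f x * ∑ i, c i * ψ i x
          = ∑ i, c i * (deriv (ψ i) x - f x * ψ i x) := by
        rw [Finset.mul_sum, ← Finset.sum_sub_distrib]
        exact Finset.sum_congr rfl fun i _ => by ring
      rw [e2, sq, sq, sq_sum', sq_sum', Finset.mul_sum, Finset.mul_sum, ← Finset.sum_sub_distrib,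
        ← Finset.sum_add_distrib]
      refine Finset.sum_congr rfl fun i _ => ?_
      rw [Finset.mul_sum, Finset.mul_sum, ← Finset.sum_sub_distrib, ← Finset.sum_add_distrib]
      exact Finset.sum_congr rfl fun j _ => by ring
    · have := IntervalIntegrable.sum (μ := volume) (a := a) (b := b) Finset.univ
        (f := fun j x => c i * c j * ((deriv (ψ i) x - f x * ψ i x) *
        (deriv (ψ j) x - f x * ψ j x) - U x * (ψ i x * ψ j x)
        + (d ^ 2 + 2 * m * d) * (ψ i x * ψ j x))) (fun j _ => (ii i j).const_mul _)
      simpa only [Finset.sum_fn] using this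
  have e3 : ∀ y, (∑ i, c i * ψ i y) ^ 2 = ∑ i, ∑ j, c i * c j * (ψ i y * ψ j y) := fun y => by
    rw [sq, sq_sum']
  rw [e1]
  beta_reduce
  rw [e3, e3, ← Finset.sum_add_distrib, Finset.mul_sum, ← Finset.sum_add_distrib]
  refine Finset.sum_congr rfl fun i _ => ?_
  rw [← Finset.sum_add_distrib, Finset.mul_sum, ← Finset.sum_add_distrib]
  exact Finset.sum_congr rfl fun j _ => by ring

lemma matrix_lim {ι : Type*} [Fintype ι] {M : ℕ → ι → ι → ℝ} {D : ι → ι → ℝ} {κ : ℝ} (hκ : 0 < κ)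
    (hM : ∀ i j, Tendsto (fun n => M n i j) atTop (𝓝 (D i j)))
    (hD : ∀ c : ι → ℝ, ∑ i, ∑ j, c i * c j * D i j ≤ -κ * ∑ i, c i ^ 2) :
    ∀ᶠ n in atTop, ∀ c : ι → ℝ, ∑ i, ∑ j, c i * c j * M n i j ≤ -(κ / 2) * ∑ i, c i ^ 2 := by
  set q : ℝ := ((Fintype.card ι : ℕ) : ℝ)
  have hq : 0 ≤ q := Nat.cast_nonneg _
  have hε : 0 < κ / 2 / (q + 1) := by positivity
  have : ∀ᶠ n in atTop, ∀ i j, |M n i j - D i j| < κ / 2 / (q + 1) := by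
    rw [eventually_all]; intro i
    rw [eventually_all]; intro j
    have := (Metric.tendsto_nhds.1 (hM i j)) _ hε
    simpa [Real.dist_eq] using this
  filter_upwards [this] with n hn c
  have h1 : ∑ i, ∑ j, c i * c j * M n i j ≤ ∑ i, ∑ j, c i * c j * D i j
      + ∑ i, ∑ j, (κ / 2 / (q + 1)) * ((c i ^ 2 + c j ^ 2) / 2) := by
    rw [← Finset.sum_add_distrib]
    refine Finset.sum_le_sum fun i _ => ?_
    rw [← Finset.sum_add_distrib]
    refine Finset.sum_le_sum fun j _ => ?_
    have e1 : c i * c j * M n i j - c i * c j * D i j ≤ |c i * c j| * |M n i j - D i j| := by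
      rw [← abs_mul, mul_sub]; exact le_abs_self _
    have e2 : |c i * c j| ≤ (c i ^ 2 + c j ^ 2) / 2 := by
      rw [abs_le]; constructor <;> nlinarith [sq_nonneg (c i + c j), sq_nonneg (c i - c j)]
    have e3 : |c i * c j| * |M n i j - D i j| ≤ (c i ^ 2 + c j ^ 2) / 2 * (κ / 2 / (q + 1)) :=
      mul_le_mul e2 (hn i j).le (abs_nonneg _) (by positivity)
    linarith
  have h2 : ∑ i : ι, ∑ j : ι, (κ / 2 / (q + 1)) * ((c i ^ 2 + c j ^ 2) / 2)
      = (κ / 2 / (q + 1)) * (q * ∑ i, c i ^ 2) := by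
    simp_rw [← Finset.mul_sum]
    congr 1
    simp_rw [add_div, Finset.sum_add_distrib]
    simp only [Finset.sum_const, Finset.card_univ, nsmul_eq_mul, ← Finset.mul_sum, ← Finset.sum_div]
    ring
  have h3 : (κ / 2 / (q + 1)) * (q * ∑ i, c i ^ 2) ≤ κ / 2 * ∑ i, c i ^ 2 := by
    have hs : 0 ≤ ∑ i, c i ^ 2 := Finset.sum_nonneg fun i _ => sq_nonneg _
    have : κ / 2 / (q + 1) * q ≤ κ / 2 := by
      rw [div_mul_eq_mul_div, div_le_iff₀ (by linarith)]; nlinarith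
    rw [← mul_assoc]
    exact mul_le_mul_of_nonneg_right this hs
  have := hD c
  linarith
end LTaux

namespace LTaux

lemma locII {U : ℝ → ℝ} (h : MemLp U 2 (volume : Measure ℝ)) (a b : ℝ) :
    IntervalIntegrable U volume a b := by
  rw [intervalIntegrable_iff]
  exact ((h.locallyIntegrable (by norm_num)).integrableOn_isCompact isCompact_uIcc).mono_set
    uIoc_subset_uIcc

lemma pos_norm {ψ : ℝ → ℝ} (h : MemLp ψ 2 (volume : Measure ℝ)) (hc : Continuous ψ) (h0 : ψ ≠ 0) :
    0 < ∫ x, ψ x ^ 2 := by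
  rw [integral_pos_iff_support_of_nonneg (fun x => sq_nonneg _) h.integrable_sq]
  apply IsOpen.measure_pos
  · exact (by fun_prop : Continuous fun x => ψ x ^ 2).isOpen_support
  · obtain ⟨x, hx⟩ := Function.ne_iff.1 h0
    exact ⟨x, by simpa using hx⟩

lemma exists_low {ι : Type*} [Fintype ι] (g : ι → ℝ) (hg : ∀ i, 0 < g i) :
    ∃ κ > 0, ∀ i, κ ≤ g i := by
  rcases isEmpty_or_nonempty ι with h | h
  · exact ⟨1, one_pos, fun i => (h.false i).elim⟩
  · obtain ⟨i, hi⟩ := Finite.exists_min g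
    exact ⟨g i, hg i, hi⟩

lemma int_dsum {ι : Type*} [Fintype ι] {g : ι → ι → ℝ → ℝ} (hg : ∀ i j, Continuous (g i j))
    (w : ι → ι → ℝ) (a b : ℝ) :
    ∫ x in a..b, ∑ i, ∑ j, w i j * g i j x = ∑ i, ∑ j, w i j * ∫ x in a..b, g i j x := by
  rw [intervalIntegral.integral_finsetSum fun i _ => Continuous.intervalIntegrable (by fun_prop) _ _]
  refine Finset.sum_congr rfl fun i _ => ?_
  rw [intervalIntegral.integral_finsetSum fun i _ => Continuous.intervalIntegrable (by fun_prop) _ _]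
  refine Finset.sum_congr rfl fun j _ => ?_
  rw [intervalIntegral.integral_const_mul]

lemma AC.sum {ι : Type*} [Fintype ι] {h h' : ι → ℝ → ℝ} (H : ∀ i, AC (h i) (h' i)) :
    AC (fun x => ∑ i, h i x) (fun x => ∑ i, h' i x) := fun a b => by
  constructor
  · have := IntervalIntegrable.sum (μ := volume) (a := a) (b := b) Finset.univ
        (f := h') (fun j _ => (H j a b).1)
    simpa only [Finset.sum_fn] using this
  · rw [intervalIntegral.integral_finsetSum fun i _ => (H i a b).1, ← Finset.sum_sub_distrib]
    exact Finset.sum_congr rfl fun i _ => (H i a b).2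

lemma comb_c1 {ι : Type*} [Fintype ι] {ψ : ι → ℝ → ℝ} (hψ : ∀ i, ContDiff ℝ 1 (ψ i))
    (c : ι → ℝ) : ContDiff ℝ 1 (fun x => ∑ i, c i * ψ i x) :=
  ContDiff.sum fun i _ => contDiff_const.mul (hψ i)

lemma formM {ι : Type*} [Fintype ι] {V₀ V F U : ℝ → ℝ} {l : ι → ℝ} {ψ ψ'' : ι → ℝ → ℝ}
    {m d a b : ℝ} (H : ∀ i, Eig V₀ V (l i) (ψ i) (ψ'' i)) (hab : a ≤ b)
    (hF : AC F (fun x => m ^ 2 - V₀ x - F x ^ 2)) (hU : ∀ x, V x ≤ U x)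
    (hUi : IntervalIntegrable U volume a b) (c : ι → ℝ) :
    qf F U m d a b (fun x => ∑ i, c i * ψ i x) ≤ ∑ i, ∑ j, c i * c j *
      ((ψ i b * deriv (ψ j) b - F b * (ψ i b * ψ j b)) - (ψ i a * deriv (ψ j) a - F a * (ψ i a * ψ j a))
      + ((m + d) ^ 2 - l i) * (∫ x in a..b, ψ i x * ψ j x) + d * (ψ i a * ψ j a + ψ i b * ψ j b)) := by
  have hc : ∀ i, Continuous (ψ i) := fun i => (H i).c1.continuous
  have hac : AC (deriv (fun x => ∑ i, c i * ψ i x)) (fun x => ∑ i, c i * ψ'' i x) := by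
    have e : deriv (fun x => ∑ i, c i * ψ i x) = fun x => ∑ i, c i * deriv (ψ i) x := by
      ext x; exact deriv_comb (fun i => (H i).c1) c x
    rw [e]
    exact AC.sum fun i => (H i).ac.const_mul (c i)
  have := formEst (d := d) (η := fun x => ∑ i, c i * (l i * ψ i x)) hab hF hU hUi
    (comb_c1 (fun i => (H i).c1) c) hac (by fun_prop) (by
      have : ∀ᵐ x, ∀ i, ψ'' i x = (l i - V₀ x - V x) * ψ i x := ae_all_iff.2 fun i => (H i).eq
      filter_upwards [this] with x hx
      rw [Finset.mul_sum, ← Finset.sum_sub_distrib]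
      exact Finset.sum_congr rfl fun i _ => by rw [hx i]; ring)
  refine this.trans (le_of_eq ?_)
  beta_reduce
  have e1 : ∫ x in a..b, ((m + d) ^ 2 * ∑ i, c i * ψ i x - ∑ i, c i * (l i * ψ i x))
      * ∑ i, c i * ψ i x = ∑ i, ∑ j, (c i * c j * ((m + d) ^ 2 - l i)) * ∫ x in a..b, ψ i x * ψ j x := by
    rw [← int_dsum (g := fun i j x => ψ i x * ψ j x) (fun i j => (hc i).mul (hc j))]
    congr 1; ext x
    have : (m + d) ^ 2 * ∑ i, c i * ψ i x - ∑ i, c i * (l i * ψ i x)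
      = ∑ i, c i * (((m + d) ^ 2 - l i) * ψ i x) := by
      rw [Finset.mul_sum, ← Finset.sum_sub_distrib]
      exact Finset.sum_congr rfl fun i _ => by ring
    rw [this, sq_sum']
    exact Finset.sum_congr rfl fun i _ => Finset.sum_congr rfl fun j _ => by ring
  have e3 : ∀ y, (∑ i, c i * ψ i y) ^ 2 = ∑ i, ∑ j, c i * c j * (ψ i y * ψ j y) :=
    fun y => by rw [sq, sq_sum']
  rw [e1, deriv_comb (fun i => (H i).c1), deriv_comb (fun i => (H i).c1), e3, e3, sq_sum', sq_sum',
    sq_sum', sq_sum']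
  simp only [Finset.mul_sum, ← Finset.sum_sub_distrib, ← Finset.sum_add_distrib]
  exact Finset.sum_congr rfl fun i _ => Finset.sum_congr rfl fun j _ => by ring

lemma mainE {ι : Type*} [Fintype ι] {V₀ V F U : ℝ → ℝ} {l : ι → ℝ} {ψ ψ'' : ι → ℝ → ℝ}
    {m d : ℝ} {a b : ℕ → ℝ} (H : ∀ i, Eig V₀ V (l i) (ψ i) (ψ'' i)) (h0 : ∀ i, ψ i ≠ 0)
    (hl : Function.Injective l) (hgt : ∀ i, (m + d) ^ 2 < l i)
    (hF : AC F (fun x => m ^ 2 - V₀ x - F x ^ 2)) (hFm : ∀ x, |F x| ≤ m) (hU : ∀ x, V x ≤ U x)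
    (hUi : ∀ a b, IntervalIntegrable U volume a b)
    (ha : Tendsto a atTop atBot) (hb : Tendsto b atTop atTop)
    (hlim : ∀ i, Tendsto (fun n => ψ i (a n)) atTop (𝓝 0) ∧
      Tendsto (fun n => deriv (ψ i) (a n)) atTop (𝓝 0) ∧
      Tendsto (fun n => ψ i (b n)) atTop (𝓝 0) ∧
      Tendsto (fun n => deriv (ψ i) (b n)) atTop (𝓝 0)) :
    ∃ κ > 0, ∀ᶠ n in atTop, ∀ c : ι → ℝ,
      qf F U m d (a n) (b n) (fun x => ∑ i, c i * ψ i x) ≤ -κ * ∑ i, c i ^ 2 := by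
  classical
  have hP : ∀ i, 0 < (l i - (m + d) ^ 2) * ∫ x, ψ i x ^ 2 := fun i =>
    mul_pos (by linarith [hgt i]) (pos_norm (H i).l2 (H i).c1.continuous (h0 i))
  obtain ⟨κ, hκ, hκi⟩ := exists_low _ hP
  refine ⟨κ / 2, by positivity, ?_⟩
  set D : ι → ι → ℝ := fun i j => if i = j then -((l i - (m + d) ^ 2) * ∫ x, ψ i x ^ 2) else 0
  have bz : ∀ {s : ℕ → ℝ} {p q : ℕ → ℝ}, Tendsto p atTop (𝓝 0) → Tendsto q atTop (𝓝 0) →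
      Tendsto (fun n => F (s n) * (p n * q n)) atTop (𝓝 0) := by
    intro s p q hp hq
    have h1 := (hp.mul hq).abs.const_mul m
    simp only [mul_zero, abs_zero] at h1
    refine squeeze_zero_norm (fun n => ?_) h1
    rw [Real.norm_eq_abs, abs_mul]
    exact mul_le_mul_of_nonneg_right (hFm _) (abs_nonneg _)
  have hM : ∀ i j, Tendsto (fun n => (ψ i (b n) * deriv (ψ j) (b n) - F (b n) * (ψ i (b n) * ψ j (b n)))
      - (ψ i (a n) * deriv (ψ j) (a n) - F (a n) * (ψ i (a n) * ψ j (a n)))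
      + ((m + d) ^ 2 - l i) * (∫ x in (a n)..(b n), ψ i x * ψ j x)
      + d * (ψ i (a n) * ψ j (a n) + ψ i (b n) * ψ j (b n))) atTop (𝓝 (D i j)) := by
    intro i j
    obtain ⟨i1, i2, i3, i4⟩ := hlim i
    obtain ⟨j1, j2, j3, j4⟩ := hlim j
    have hint : Tendsto (fun n => ∫ x in (a n)..(b n), ψ i x * ψ j x) atTop
        (𝓝 (if i = j then ∫ x, ψ i x ^ 2 else 0)) := by
      by_cases hij : i = j
      · subst hij
        simp only [if_true, ← sq]
        exact intervalIntegral_tendsto_integral (H i).l2.integrable_sq ha hb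
      · rw [if_neg hij]
        have hne : l i - l j ≠ 0 := sub_ne_zero.2 fun e => hij (hl e)
        have ci := LTaux.c1 (H i).c1
        have cj := LTaux.c1 (H j).c1
        have K : AC (fun x => deriv (ψ i) x * ψ j x + -1 * (ψ i x * deriv (ψ j) x))
            (fun x => (l i - l j) * (ψ i x * ψ j x)) := by
          refine AC.congr_ae (((H i).ac.mul (AC.of_deriv cj.2.2 cj.2.1)).add
            (((AC.of_deriv ci.2.2 ci.2.1).mul (H j).ac).const_mul (-1))) ?_
          filter_upwards [(H i).eq, (H j).eq] with x hx hy
          rw [hx, hy]; ring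
        have e : ∀ n, ∫ x in (a n)..(b n), ψ i x * ψ j x = (l i - l j)⁻¹ *
          ((deriv (ψ i) (b n) * ψ j (b n) + -1 * (ψ i (b n) * deriv (ψ j) (b n)))
            - (deriv (ψ i) (a n) * ψ j (a n) + -1 * (ψ i (a n) * deriv (ψ j) (a n)))) := by
          intro n
          rw [← (K (a n) (b n)).2, intervalIntegral.integral_const_mul, inv_mul_cancel_left₀ hne]
        simp_rw [e]
        have := ((((i4.mul j3).add ((i3.mul j4).const_mul (-1)))).sub
          ((i2.mul j1).add ((i1.mul j2).const_mul (-1)))).const_mul (l i - l j)⁻¹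
        simpa using this
    have := ((((i3.mul j4).sub (bz (s := b) i3 j3)).sub ((i1.mul j2).sub (bz (s := a) i1 j1))).add
      (hint.const_mul ((m + d) ^ 2 - l i))).add (((i1.mul j1).add (i3.mul j3)).const_mul d)
    convert this using 2
    simp only [D]
    split_ifs <;> ring
  have hD : ∀ c : ι → ℝ, ∑ i, ∑ j, c i * c j * D i j ≤ -κ * ∑ i, c i ^ 2 := by
    intro c
    rw [Finset.mul_sum]
    refine Finset.sum_le_sum fun i _ => ?_
    simp only [D, mul_ite, mul_zero, Finset.sum_ite_eq, Finset.mem_univ, if_true]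
    nlinarith [mul_le_mul_of_nonneg_left (hκi i) (sq_nonneg (c i))]
  have hab : ∀ᶠ n in atTop, a n ≤ b n := by
    filter_upwards [ha.eventually_le_atBot 0, hb.eventually_ge_atTop 0] with n h1 h2
    linarith
  filter_upwards [matrix_lim hκ hM hD, hab] with n hn hn' c
  exact (formM H hn' hF hU (hUi _ _) c).trans (hn c)

lemma R_lim {α β F U : ℝ → ℝ} {f g : ℕ → ℝ → ℝ} {m d a b : ℝ} (hα : ContDiff ℝ 1 α)
    (hβ : ContDiff ℝ 1 β) (hab : a ≤ b) (hF : Continuous F)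
    (hU : IntervalIntegrable U volume a b) (hf : ∀ n, Continuous (f n)) (hg : ∀ n, Continuous (g n))
    (hfm : ∀ n x, |f n x| ≤ m) (hfl : ∀ x, Tendsto (fun n => f n x) atTop (𝓝 (F x)))
    (hgl : Tendsto (fun n => ∫ x in a..b, |g n x - U x|) atTop (𝓝 0)) :
    Tendsto (fun n => R (f n) (g n) m d a b α β) atTop (𝓝 (R F U m d a b α β)) := by
  obtain ⟨a1, a2, -⟩ := LTaux.c1 hα
  obtain ⟨b1, b2, -⟩ := LTaux.c1 hβ
  have split : ∀ (f g : ℝ → ℝ), Continuous f → IntervalIntegrable g volume a b →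
      R f g m d a b α β = ((∫ x in a..b, (deriv α x - f x * α x) * (deriv β x - f x * β x))
        - ∫ x in a..b, g x * (α x * β x)) + (∫ x in a..b, (d ^ 2 + 2 * m * d) * (α x * β x))
        + d * (α a * β a + α b * β b) := by
    intro f g hf hg
    have i1 : IntervalIntegrable (fun x => (deriv α x - f x * α x) * (deriv β x - f x * β x))
      volume a b := Continuous.intervalIntegrable (by fun_prop) _ _
    have i2 : IntervalIntegrable (fun x => g x * (α x * β x)) volume a b :=
      hg.mul_continuousOn (by fun_prop)
    have i3 : IntervalIntegrable (fun x => (d ^ 2 + 2 * m * d) * (α x * β x))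
      volume a b := Continuous.intervalIntegrable (by fun_prop) _ _
    unfold R
    rw [intervalIntegral.integral_add (i1.sub i2) i3, intervalIntegral.integral_sub i1 i2]
  have hgi : ∀ n, IntervalIntegrable (g n) volume a b := fun n => (hg n).intervalIntegrable _ _
  rw [split F U hF hU]
  simp_rw [fun n => split (f n) (g n) (hf n) (hgi n)]
  refine ((Tendsto.sub ?_ ?_).add_const _).add_const _
  · refine intervalIntegral.tendsto_integral_filter_of_dominated_convergence
      (fun x => (|deriv α x| + m * |α x|) * (|deriv β x| + m * |β x|)) ?_ ?_ ?_ ?_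
    · refine Eventually.of_forall fun n => ?_
      have := hf n
      exact (by fun_prop : Continuous fun x => (deriv α x - f n x * α x) *
        (deriv β x - f n x * β x)).aestronglyMeasurable
    · refine Eventually.of_forall fun n => Eventually.of_forall fun x _ => ?_
      have k : ∀ p q : ℝ, |p - f n x * q| ≤ |p| + m * |q| := fun p q => by
        refine (abs_sub _ _).trans (add_le_add le_rfl ?_)
        rw [abs_mul]; exact mul_le_mul_of_nonneg_right (hfm n x) (abs_nonneg _)
      rw [Real.norm_eq_abs, abs_mul]
      exact mul_le_mul (k _ _) (k _ _) (abs_nonneg _) ((abs_nonneg _).trans (k _ _))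
    · exact Continuous.intervalIntegrable (by fun_prop) _ _
    · refine Eventually.of_forall fun x _ => ?_
      exact ((tendsto_const_nhds.sub ((hfl x).mul_const _))).mul
        (tendsto_const_nhds.sub ((hfl x).mul_const _))
  · obtain ⟨C, hC⟩ := isCompact_Icc.exists_bound_of_continuousOn (s := Icc a b)
      (a1.mul b1).continuousOn
    rw [tendsto_iff_dist_tendsto_zero]
    refine squeeze_zero (fun _ => dist_nonneg) (fun n => ?_) (by simpa using hgl.const_mul C)
    rw [Real.dist_eq, ← intervalIntegral.integral_sub ((hgi n).mul_continuousOn (by fun_prop))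
      (hU.mul_continuousOn (by fun_prop)), ← intervalIntegral.integral_const_mul]
    have hi : IntervalIntegrable (fun x => |g n x - U x|) volume a b := ((hgi n).sub hU).abs
    refine (intervalIntegral.abs_integral_le_integral_abs hab).trans ?_
    refine intervalIntegral.integral_mono_on hab ?_ (hi.const_mul C) ?_
    · exact (((hgi n).mul_continuousOn (by fun_prop)).sub (hU.mul_continuousOn (by fun_prop))).abs
    · intro x hx
      rw [← sub_mul, abs_mul, mul_comm]
      exact mul_le_mul_of_nonneg_right (hC x hx) (abs_nonneg _)

lemma pert {ι : Type*} [Fintype ι] {ψ : ι → ℝ → ℝ} {F U : ℝ → ℝ} {f g : ℕ → ℝ → ℝ}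
    {m d a b κ : ℝ} (hψ : ∀ i, ContDiff ℝ 1 (ψ i)) (hab : a ≤ b) (hF : Continuous F)
    (hU : IntervalIntegrable U volume a b) (hf : ∀ n, Continuous (f n)) (hg : ∀ n, Continuous (g n))
    (hfm : ∀ n x, |f n x| ≤ m) (hfl : ∀ x, Tendsto (fun n => f n x) atTop (𝓝 (F x)))
    (hgl : Tendsto (fun n => ∫ x in a..b, |g n x - U x|) atTop (𝓝 0)) (hκ : 0 < κ)
    (hq : ∀ c : ι → ℝ, qf F U m d a b (fun x => ∑ i, c i * ψ i x) ≤ -κ * ∑ i, c i ^ 2) :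
    ∀ᶠ n in atTop, ∀ c : ι → ℝ, c ≠ 0 →
      qf (f n) (g n) m d a b (fun x => ∑ i, c i * ψ i x) < 0 := by
  have := matrix_lim hκ (fun i j => R_lim (d := d) (hψ i) (hψ j) hab hF hU hf hg hfm hfl hgl)
    (fun c => by rw [← qf_sum hψ hF hU]; exact hq c)
  filter_upwards [this] with n hn c hc
  rw [qf_sum hψ (hf n) ((hg n).intervalIntegrable _ _)]
  refine (hn c).trans_lt ?_
  obtain ⟨i, hi⟩ := Function.ne_iff.1 hc
  have : 0 < ∑ i, c i ^ 2 := Finset.sum_pos' (fun i _ => sq_nonneg _)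
    ⟨i, Finset.mem_univ _, by have : c i ≠ 0 := hi
                              positivity⟩
  nlinarith
end LTaux

namespace LTaux

lemma smF {F : ℝ → ℝ} {m : ℝ} (hc : Continuous F) (ha : Antitone F) (hm : ∀ x, |F x| ≤ m) :
    ∃ f f' : ℕ → ℝ → ℝ, (∀ n x, HasDerivAt (f n) (f' n x) x) ∧ (∀ n, Continuous (f' n)) ∧
      (∀ n x, f' n x ≤ 0) ∧ (∀ n x, |f n x| ≤ m) ∧
      ∀ x, Tendsto (fun n => f n x) atTop (𝓝 (F x)) := by
  have hh : ∀ n : ℕ, 0 < 1 / ((n : ℝ) + 1) := fun n => Nat.one_div_pos_of_nat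
  have hi : ∀ a b, IntervalIntegrable F volume a b := fun a b => hc.intervalIntegrable _ _
  have key : ∀ (n : ℕ) x, F (x + 1 / ((n : ℝ) + 1)) ≤ ((n : ℝ) + 1) * ∫ y in x..(x + 1 / ((n : ℝ) + 1)), F y ∧
      ((n : ℝ) + 1) * (∫ y in x..(x + 1 / ((n : ℝ) + 1)), F y) ≤ F x := by
    intro n x
    have hp : (0 : ℝ) < (n : ℝ) + 1 := by positivity
    have hx : x ≤ x + 1 / ((n : ℝ) + 1) := by linarith [hh n]
    have h1 := intervalIntegral.integral_mono_on hx (continuous_const.intervalIntegrable (μ := volume) _ _) (hi _ _)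
      (f := fun _ => F (x + 1 / ((n : ℝ) + 1))) (fun y hy => ha hy.2)
    have h2 := intervalIntegral.integral_mono_on hx (hi _ _) (continuous_const.intervalIntegrable (μ := volume) _ _)
      (g := fun _ => F x) (fun y hy => ha hy.1)
    rw [intervalIntegral.integral_const, smul_eq_mul] at h1 h2
    have e : x + 1 / ((n : ℝ) + 1) - x = 1 / ((n : ℝ) + 1) := by ring
    rw [e] at h1 h2
    have h3 := mul_le_mul_of_nonneg_left h1 hp.le
    have h4 := mul_le_mul_of_nonneg_left h2 hp.le
    have e2 : ∀ y : ℝ, ((n : ℝ) + 1) * (1 / ((n : ℝ) + 1) * y) = y := fun y => by field_simp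
    rw [e2] at h3 h4
    exact ⟨h3, h4⟩
  refine ⟨fun n x => ((n : ℝ) + 1) * ∫ y in x..(x + 1 / ((n : ℝ) + 1)), F y,
    fun n x => ((n : ℝ) + 1) * (F (x + 1 / ((n : ℝ) + 1)) - F x), ?_, ?_, ?_, ?_, ?_⟩
  · intro n x
    have e : (fun x => ((n : ℝ) + 1) * ∫ y in x..(x + 1 / ((n : ℝ) + 1)), F y) =
        fun x => ((n : ℝ) + 1) * ((∫ y in (0:ℝ)..(x + 1 / ((n : ℝ) + 1)), F y) - ∫ y in (0:ℝ)..x, F y) := by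
      ext x
      rw [intervalIntegral.integral_interval_sub_left (hi _ _) (hi _ _)]
    beta_reduce
    rw [e]
    have d : ∀ x, HasDerivAt (fun u => ∫ y in (0:ℝ)..u, F y) (F x) x := fun x =>
      intervalIntegral.integral_hasDerivAt_right (hi _ _) (hc.stronglyMeasurableAtFilter _ _) hc.continuousAt
    exact (((d (x + 1 / ((n : ℝ) + 1))).comp_add_const x _).sub (d x)).const_mul _
  · intro n; fun_prop
  · intro n x
    have : F (x + 1 / ((n : ℝ) + 1)) ≤ F x := ha (by linarith [hh n])
    exact mul_nonpos_of_nonneg_of_nonpos (by positivity) (by linarith)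
  · intro n x
    have := key n x
    rw [abs_le]
    have h1 := abs_le.1 (hm (x + 1 / ((n : ℝ) + 1)))
    have h2 := abs_le.1 (hm x)
    constructor <;> linarith [this.1, this.2]
  · intro x
    refine tendsto_of_tendsto_of_tendsto_of_le_of_le ?_ tendsto_const_nhds (fun n => (key n x).1) (fun n => (key n x).2)
    have := (hc.tendsto (x + 0)).comp (tendsto_one_div_add_atTop_nhds_zero_nat.const_add x)
    simpa [Function.comp_def] using this

lemma smU {U : ℝ → ℝ} (hU : MemLp U 2 volume) {a b : ℝ} (hab : a ≤ b) :
    ∃ g : ℕ → ℝ → ℝ, (∀ n, Continuous (g n)) ∧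
      Tendsto (fun n => ∫ x in a..b, |g n x - U x|) atTop (𝓝 0) ∧
      ∃ e : ℕ → ℝ, Tendsto e atTop (𝓝 (∫ x, U x ^ 2)) ∧ ∀ n, ∫ x in a..b, g n x ^ 2 ≤ e n := by
  have h2 : ENNReal.ofReal 2 = 2 := by simp
  have hh : ∀ n : ℕ, 0 < 1 / ((n : ℝ) + 1) := fun n => Nat.one_div_pos_of_nat
  have ex : ∀ n : ℕ, ∃ g : ℝ → ℝ, Continuous g ∧ MemLp g 2 volume ∧
      ∫ x, (g x - U x) ^ 2 ≤ (1 / ((n : ℝ) + 1)) ^ 2 := by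
    intro n
    obtain ⟨g, hg, hgm⟩ := MemLp.exists_boundedContinuous_integral_rpow_sub_le (μ := volume) (f := U)
      (p := 2) (by norm_num) (by rw [h2]; exact hU) (ε := (1 / ((n : ℝ) + 1)) ^ 2) (pow_pos (hh n) 2)
    refine ⟨g, g.continuous, by rwa [h2] at hgm, ?_⟩
    refine le_of_eq_of_le ?_ hg
    congr 1; ext x
    rw [Real.rpow_two, Real.norm_eq_abs, sq_abs]; ring
  choose g hgc hgm hgi using ex
  have hsub : ∀ n, Integrable (fun x => (g n x - U x) ^ 2) volume := fun n => ((hgm n).sub hU).integrable_sq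
  have hloc : ∀ n, IntervalIntegrable (fun x => |g n x - U x|) volume a b := fun n =>
    ((((hgc n).intervalIntegrable _ _).sub (locII hU a b))).abs
  have hη := tendsto_one_div_add_atTop_nhds_zero_nat (𝕜 := ℝ)
  refine ⟨g, hgc, ?_, fun n => (1 + 1 / ((n : ℝ) + 1)) * (∫ x, U x ^ 2) + (1 / ((n : ℝ) + 1)) ^ 2 + 1 / ((n : ℝ) + 1), ?_, ?_⟩
  · refine squeeze_zero (g := fun n : ℕ => (1 / ((n : ℝ) + 1)) / 2 * (b - a) + (1 / ((n : ℝ) + 1)) / 2) (fun n => ?_) (fun n => ?_) ?_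
    · exact intervalIntegral.integral_nonneg hab fun x _ => abs_nonneg _
    · set η := 1 / ((n : ℝ) + 1)
      have hp : 0 < η := hh n
      have : ∫ x in a..b, |g n x - U x| ≤ ∫ x in a..b, (η / 2 + (1 / (2 * η)) * (g n x - U x) ^ 2) := by
        refine intervalIntegral.integral_mono_on hab (hloc n) ?_ fun x _ => ?_
        · exact (continuous_const.intervalIntegrable _ _).add (((hsub n).intervalIntegrable).const_mul _)
        · have : η / 2 + (1 / (2 * η)) * (g n x - U x) ^ 2 - |g n x - U x| = (1 / (2 * η)) * (|g n x - U x| - η) ^ 2 := by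
            rw [← sq_abs (g n x - U x)]; field_simp; ring
          have h3 : 0 ≤ (1 / (2 * η)) * (|g n x - U x| - η) ^ 2 := by positivity
          linarith
      refine this.trans ?_
      rw [intervalIntegral.integral_add (continuous_const.intervalIntegrable _ _)
        (((hsub n).intervalIntegrable).const_mul _), intervalIntegral.integral_const_mul,
        intervalIntegral.integral_const, smul_eq_mul, mul_comm (b - a)]
      have h4 := (setInt_le (hsub n) (fun x => sq_nonneg _) hab).trans (hgi n)
      have h5 := mul_le_mul_of_nonneg_left h4 (show 0 ≤ 1 / (2 * η) by positivity)
      have h6 : 1 / (2 * η) * η ^ 2 = η / 2 := by field_simp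
      linarith
    · have := ((hη.div_const 2).mul_const (b - a)).add (hη.div_const 2)
      simpa [Function.comp_def] using this
  · have := (((hη.const_add 1).mul_const (∫ x, U x ^ 2)).add (hη.pow 2)).add hη
    simpa [Function.comp_def] using this
  · intro n
    beta_reduce
    set η := 1 / ((n : ℝ) + 1)
    have hp : 0 < η := hh n
    have i1 : IntervalIntegrable (fun x => (1 + η) * U x ^ 2) volume a b := (hU.integrable_sq.intervalIntegrable).const_mul _
    have i2 : IntervalIntegrable (fun x => (1 + 1 / η) * (g n x - U x) ^ 2) volume a b := ((hsub n).intervalIntegrable).const_mul _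
    have : ∫ x in a..b, g n x ^ 2 ≤ ∫ x in a..b, ((1 + η) * U x ^ 2 + (1 + 1 / η) * (g n x - U x) ^ 2) := by
      refine intervalIntegral.integral_mono_on hab (((hgc n).pow 2).intervalIntegrable _ _) (i1.add i2) fun x _ => ?_
      have : (1 + η) * U x ^ 2 + (1 + 1 / η) * (g n x - U x) ^ 2 - g n x ^ 2 = (1 / η) * (g n x - U x - η * U x) ^ 2 := by
        field_simp; ring
      have h3 : 0 ≤ (1 / η) * (g n x - U x - η * U x) ^ 2 := by positivity
      linarith
    refine this.trans ?_
    rw [intervalIntegral.integral_add i1 i2, intervalIntegral.integral_const_mul, intervalIntegral.integral_const_mul]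
    have h3 := setInt_le hU.integrable_sq (fun x => sq_nonneg _) hab
    have h4 := (setInt_le (hsub n) (fun x => sq_nonneg _) hab).trans (hgi n)
    have h5 := mul_le_mul_of_nonneg_left h4 (show 0 ≤ 1 + 1 / η by positivity)
    have h6 := mul_le_mul_of_nonneg_left h3 (show 0 ≤ 1 + η by positivity)
    have h7 : (1 + 1 / η) * η ^ 2 = η ^ 2 + η := by field_simp
    linarith

end LTaux

namespace LTaux

def combL {k : ℕ} (ψ : Fin k → ℝ → ℝ) : (Fin k → ℝ) →ₗ[ℝ] (ℝ → ℝ) where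
  toFun c := fun x => ∑ i, c i * ψ i x
  map_add' c e := by
    ext x; simp only [Pi.add_apply, add_mul, Finset.sum_add_distrib]
  map_smul' r c := by
    ext x
    simp only [Pi.smul_apply, smul_eq_mul, RingHom.id_apply, Finset.mul_sum, mul_assoc]

lemma assemble {V₀ V φ φ'' : ℝ → ℝ} {m c : ℝ} (hm : 0 ≤ m)
    (HP : Pos (fun x => m ^ 2 - V₀ x) φ φ'') (hV : ∀ x, 0 ≤ V₀ x)
    (hl : MonotoneOn V₀ (Iic c)) (hr : AntitoneOn V₀ (Ici c))
    (hVp : MemLp (fun x => max (V x) 0) 2 volume)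
    {n : ℕ} {l : Fin n → ℝ} {ψ ψ'' : Fin n → ℝ → ℝ} (H : ∀ i, Eig V₀ V (l i) (ψ i) (ψ'' i))
    (h0 : ∀ i, ψ i ≠ 0) (hanti : StrictAnti l) (hlm : ∀ i, m ^ 2 < l i) :
    ∑ i, (√(l i) - m) ^ 3 ≤ 3 / 16 * ∫ x, (max (V x) 0) ^ 2 := by
  obtain ⟨F, hF, hFa, hFm⟩ := HP.F hm hV hl hr
  have hB : ∀ x, V₀ x ≤ V₀ c := fun x => by
    rcases le_total x c with h | h
    · exact hl h (mem_Iic.2 le_rfl) h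
    · exact hr (mem_Ici.2 le_rfl) h h
  obtain ⟨a, b, ha, hb, hlim⟩ := two_seq H (fun i => (sq_nonneg m).trans (hlm i).le) hB (hV c) hVp
  have hsq : ∀ i, m < √(l i) := fun i => Real.lt_sqrt_of_sq_lt (hlm i)
  have step : ∀ t ∈ Ioo (0 : ℝ) 1, ∑ i, (t * (√(l i) - m)) ^ 3 ≤ 3 / 16 * ∫ x, (max (V x) 0) ^ 2 := by
    intro t ht
    set d : Fin n → ℝ := fun i => t * (√(l i) - m) with hd
    have hd0 : ∀ i, 0 ≤ d i := fun i => mul_nonneg ht.1.le (by linarith [hsq i])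
    have hdl : ∀ i, (m + d i) ^ 2 < l i := fun i => by
      have h1 : m + d i < √(l i) := by
        have : t * (√(l i) - m) < 1 * (√(l i) - m) := mul_lt_mul_of_pos_right ht.2 (by linarith [hsq i])
        simp only [hd]; linarith
      have h2 : 0 ≤ m + d i := by linarith [hd0 i]
      exact (Real.lt_sqrt h2).1 h1
    let σ : ∀ k : Fin n, Fin (k + 1) → Fin n := fun k => Fin.castLE k.2
    have hM := fun k : Fin n => mainE (ι := Fin (k + 1)) (l := l ∘ σ k) (ψ := fun i => ψ (σ k i))
      (ψ'' := fun i => ψ'' (σ k i)) (m := m) (d := d k) (U := fun x => max (V x) 0)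
      (fun i => H (σ k i)) (fun i => h0 _) (hanti.injective.comp (Fin.castLE_injective _))
      (fun i => (hdl k).trans_le (hanti.antitone (by
        rw [Fin.le_def]; simp only [σ, Fin.val_castLE]; omega)))
      hF hFm (fun x => le_max_left _ _) (fun a b => locII hVp a b) ha hb (fun i => hlim _)
    choose κ hκ hev using hM
    have hab : ∀ᶠ j in atTop, a j ≤ b j := by
      filter_upwards [ha.eventually_le_atBot 0, hb.eventually_ge_atTop 0] with j h1 h2
      exact h1.trans h2
    obtain ⟨j, hj, hab⟩ := ((eventually_all.2 hev).and hab).exists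
    obtain ⟨f, f', hf, hf', hfn, hfm, hfl⟩ := smF hF.continuous hFa hFm
    obtain ⟨g, hgc, hgl, e, he, hge⟩ := smU hVp hab
    have hP := fun k : Fin n => pert (ψ := fun i => ψ (σ k i)) (fun i => (H (σ k i)).c1) hab hF.continuous
      (locII hVp _ _) (fun n => continuous_iff_continuousAt.2 fun x => (hf n x).continuousAt) hgc hfm hfl hgl
      (hκ k) (hj k)
    have hfin : ∀ᶠ q in atTop, ∑ i, d i ^ 3 ≤ 3 / 16 * e q := by
      filter_upwards [eventually_all.2 hP] with q hq
      have := T hab (hf q) (hf' q) (hfn q) (hfm q) n (g q) d (hgc q) hd0 (fun k =>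
        ⟨combL (fun i => ψ (σ k i)), fun c => comb_c1 (fun i => (H (σ k i)).c1) c, fun c hc => hq k c hc⟩)
      exact this.trans (mul_le_mul_of_nonneg_left (hge q) (by norm_num))
    exact ge_of_tendsto (he.const_mul _) hfin
  have hlimt : Tendsto (fun t : ℝ => ∑ i, (t * (√(l i) - m)) ^ 3) (𝓝[<] 1) (𝓝 (∑ i, (1 * (√(l i) - m)) ^ 3)) :=
    (Continuous.tendsto (by fun_prop) _).mono_left nhdsWithin_le_nhds
  simp only [one_mul] at hlimt
  exact le_of_tendsto hlimt (by
    filter_upwards [Ioo_mem_nhdsLT (show (0:ℝ) < 1 by norm_num)] with t ht using step t ht)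

end LTaux
open LTaux

theorem sum_dist_first_eigenvalue_le
    (V₀ V : ℝ → ℝ)
    (hV₀nonneg : ∀ x, 0 ≤ V₀ x)
    (hV₀singlewell : ∃ c : ℝ, MonotoneOn V₀ (Set.Iic c) ∧ AntitoneOn V₀ (Set.Ici c))
    (hV₀int : Integrable (fun x => (1 + |x|) * V₀ x) (volume : Measure ℝ))
    (hVmeas : Measurable V)
    (hVplus : MemLp (fun x => max (V x) 0) 2 (volume : Measure ℝ))
    (μ₁ : ℝ) (hμ₁ : 0 < μ₁)
    (hground : IsEigenvalueWithPositiveEigenfunction V₀ (-μ₁))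
    (N : ℕ) (E : Fin N → ℝ)
    (hEneg : ∀ k, E k < 0)
    (hEdist : Function.Injective E)
    (hEeig : ∀ k, IsEigenvalue (fun x => V₀ x + V x) (E k)) :
    ∑ k : Fin N, max (Real.sqrt |E k| - Real.sqrt μ₁) 0 ^ 3
      ≤ 3 / 16 * ∫ x : ℝ, (max (V x) 0) ^ 2 := by
  classical
  obtain ⟨c, hl, hr⟩ := hV₀singlewell
  obtain ⟨φ, φ'', hφ, hφ2, hφ1, hφac, hφe⟩ := hground
  have hms : √μ₁ ^ 2 = μ₁ := Real.sq_sqrt hμ₁.le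
  have HP : LTaux.Pos (fun x => √μ₁ ^ 2 - V₀ x) φ φ'' := ⟨hφ, hφ2, hφ1, hφac, by
    filter_upwards [hφe] with x hx
    rw [hms]; linarith⟩
  set S : Finset ℝ := (Finset.univ.filter fun k => E k < -μ₁).image E with hS
  have hSe : ∀ y ∈ S, y < -μ₁ ∧ IsEigenvalue (fun x => V₀ x + V x) y := by
    intro y hy
    simp only [hS, Finset.mem_image, Finset.mem_filter, Finset.mem_univ, true_and] at hy
    obtain ⟨k, hk, rfl⟩ := hy
    exact ⟨hk, hEeig k⟩
  have hsum : ∑ k : Fin N, max (√|E k| - √μ₁) 0 ^ 3 = ∑ y ∈ S, (√(-y) - √μ₁) ^ 3 := by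
    rw [hS, Finset.sum_image hEdist.injOn, Finset.sum_filter]
    refine Finset.sum_congr rfl fun k _ => ?_
    rw [abs_of_neg (hEneg k)]
    split_ifs with h
    · rw [max_eq_left]
      have := Real.sqrt_le_sqrt (show μ₁ ≤ -E k by linarith)
      linarith
    · rw [max_eq_right]
      · norm_num
      · have := Real.sqrt_le_sqrt (show -E k ≤ μ₁ by linarith)
        linarith
  rw [hsum]
  set o := S.orderEmbOfFin rfl with ho
  have hmem : ∀ i, o i ∈ S := fun i => Finset.orderEmbOfFin_mem S rfl i
  have hsum2 : ∑ y ∈ S, (√(-y) - √μ₁) ^ 3 = ∑ i, (√(-o i) - √μ₁) ^ 3 := by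
    have : S = Finset.univ.image o := by
      ext y
      simp only [Finset.mem_image, Finset.mem_univ, true_and]
      have := Finset.range_orderEmbOfFin S rfl
      rw [Set.ext_iff] at this
      exact (this y).symm
    conv_lhs => rw [this]
    rw [Finset.sum_image o.injective.injOn]
  rw [hsum2]
  have hE := fun i => (hSe _ (hmem i)).2
  choose ψ ψ'' h0 h2 h1 hac he using hE
  exact assemble (l := fun i => -o i) (Real.sqrt_nonneg _) HP hV₀nonneg hl hr hVplus
    (fun i => ⟨h2 i, h1 i, hac i, by
      filter_upwards [he i] with x hx
      linarith⟩) h0 (fun i j hij => neg_lt_neg (o.strictMono hij))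
    (fun i => by rw [hms]; linarith [(hSe _ (hmem i)).1])
end

section
/- Let σ ∈ ℝ. Let V₀ : (0,∞) → ℝ be non-negative, non-increasing and integrable on (0,∞), and let V : (0,∞) → ℝ be measurable with positive part V₊ ∈ L²(0,∞). Suppose μ₁ > 0 and that −μ₁ is a σ-Robin eigenvalue of −d²/dr² − V₀ on L²(0,∞) possessing a strictly positive eigenfunction (i.e. −μ₁ is the lowest Robin eigenvalue). Then for every N ∈ ℕ and all distinct negative reals E₁, …, E_N, each of which is a σ-Robin eigenvalue of −d²/dr² − (V₀ + V) on L²(0,∞), one has Σ_{k=1}^N max(√|E_k| − √μ₁, 0)³ ≤ (3/8) ∫_0^∞ V₊(r)² dr. -/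
open MeasureTheory Real Filter Set
open scoped Topology

/-- `E` is a `σ`-Robin eigenvalue of `-d²/dr² - W` on `L²(0,∞)`: there is a
nonzero `ψ ∈ L²(0,∞)`, continuously differentiable on `[0,∞)` with `ψ'` locally
absolutely continuous (encoded via a locally integrable a.e.-derivative `ψ''`),
satisfying `ψ'(0) - σψ(0) = 0` and `-ψ'' - Wψ = Eψ` a.e. on `(0,∞)`. -/
def IsRobinEigenvalue (σ : ℝ) (W : ℝ → ℝ) (E : ℝ) : Prop :=
  ∃ ψ ψ'' : ℝ → ℝ,
    ¬ (∀ᵐ r ∂(volume.restrict (Set.Ioi (0 : ℝ))), ψ r = 0) ∧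
    MemLp ψ 2 (volume.restrict (Set.Ioi (0 : ℝ))) ∧
    ContDiffOn ℝ 1 ψ (Set.Ici 0) ∧
    (∀ a b : ℝ, 0 ≤ a → 0 ≤ b → IntervalIntegrable ψ'' volume a b ∧
      ∫ r in a..b, ψ'' r = derivWithin ψ (Set.Ici 0) b - derivWithin ψ (Set.Ici 0) a) ∧
    derivWithin ψ (Set.Ici 0) 0 - σ * ψ 0 = 0 ∧
    (∀ᵐ r ∂(volume.restrict (Set.Ioi (0 : ℝ))), -ψ'' r - W r * ψ r = E * ψ r)

/-- `E` is a `σ`-Robin eigenvalue of `-d²/dr² - W` possessing a strictly positive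
eigenfunction (i.e. `E` is the lowest Robin eigenvalue). -/
def IsRobinEigenvalueWithPositiveEigenfunction (σ : ℝ) (W : ℝ → ℝ) (E : ℝ) : Prop :=
  ∃ ψ ψ'' : ℝ → ℝ,
    (∀ r ∈ Set.Ici (0 : ℝ), 0 < ψ r) ∧
    MemLp ψ 2 (volume.restrict (Set.Ioi (0 : ℝ))) ∧
    ContDiffOn ℝ 1 ψ (Set.Ici 0) ∧
    (∀ a b : ℝ, 0 ≤ a → 0 ≤ b → IntervalIntegrable ψ'' volume a b ∧
      ∫ r in a..b, ψ'' r = derivWithin ψ (Set.Ici 0) b - derivWithin ψ (Set.Ici 0) a) ∧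
    derivWithin ψ (Set.Ici 0) 0 - σ * ψ 0 = 0 ∧
    (∀ᵐ r ∂(volume.restrict (Set.Ioi (0 : ℝ))), -ψ'' r - W r * ψ r = E * ψ r)


/-- `F` is a primitive of the locally integrable function `f` on `[0,∞)`. -/
def Prim (F f : ℝ → ℝ) : Prop :=
  ∀ b : ℝ, 0 ≤ b → IntervalIntegrable f volume 0 b ∧ ∫ x in (0:ℝ)..b, f x = F b - F 0

lemma Prim.ac {F f : ℝ → ℝ} (h : Prim F f) (b : ℝ) (hb : 0 ≤ b) :
    ∃ H : ℝ → ℝ, AbsolutelyContinuousOnInterval H 0 b ∧ (∀ x ∈ Icc 0 b, H x = F x) ∧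
      ∀ᵐ x, x ∈ uIcc 0 b → deriv H x = f x := by
  refine ⟨fun x => F 0 + ∫ t in (0:ℝ)..x, f t, ?_, ?_, ?_⟩
  · have h1 := (h b hb).1.absolutelyContinuousOnInterval_intervalIntegral (c := 0) (by simp)
    have h2 : AbsolutelyContinuousOnInterval (fun _ : ℝ => F 0) 0 b := by
      apply (LipschitzOnWith.absolutelyContinuousOnInterval (K := 0))
      exact (LipschitzWith.const _).lipschitzOnWith
    exact h2.add h1
  · intro x hx
    have := (h x hx.1).2
    simp only [this]; ring
  · filter_upwards [(h b hb).1.ae_hasDerivAt_integral] with x hx hx2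
    exact ((hx hx2 0 (by simp)).const_add (F 0)).deriv

lemma Prim.mul {F f H h : ℝ → ℝ} (hF : Prim F f) (hH : Prim H h) :
    Prim (fun x => F x * H x) (fun x => f x * H x + F x * h x) := by
  intro b hb
  obtain ⟨F1, a1, e1, d1⟩ := hF.ac b hb
  obtain ⟨H1, a2, e2, d2⟩ := hH.ac b hb
  have key : ∀ᵐ x, x ∈ uIoc 0 b → deriv F1 x * H1 x + F1 x * deriv H1 x
      = f x * H x + F x * h x := by
    filter_upwards [d1, d2] with x hx1 hx2 hx
    have hx' := uIoc_subset_uIcc hx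
    rw [hx1 hx', hx2 hx']
    rw [uIcc_of_le hb] at hx'
    rw [e1 x hx', e2 x hx']
  constructor
  · have i1 := (a1.intervalIntegrable_deriv.mul_continuousOn a2.continuousOn).add
      (a2.intervalIntegrable_deriv.continuousOn_mul a1.continuousOn)
    refine i1.congr_ae ?_
    rw [Filter.EventuallyEq, ae_restrict_iff' measurableSet_uIoc]
    exact key
  · rw [← intervalIntegral.integral_congr_ae key, a1.integral_deriv_mul_eq_sub a2,
      e1 b ⟨hb, le_rfl⟩, e2 b ⟨hb, le_rfl⟩, e1 0 ⟨le_rfl, hb⟩, e2 0 ⟨le_rfl, hb⟩]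

lemma Prim.continuousOn {F f : ℝ → ℝ} (h : Prim F f) : ContinuousOn F (Ici 0) := by
  intro x hx
  obtain ⟨H, a, e, -⟩ := h.ac (x + 1) (by have : (0:ℝ) ≤ x := hx; linarith)
  have hx0 : (0:ℝ) ≤ x := hx
  have h1 : ContinuousOn F (Icc 0 (x+1)) := by
    have := a.continuousOn
    rw [uIcc_of_le (by linarith)] at this
    exact this.congr (fun y hy => (e y hy).symm)
  have h2 := h1 x ⟨hx0, by linarith⟩
  refine h2.mono_of_mem_nhdsWithin ?_
  rw [← Ici_inter_Iic]
  exact inter_mem self_mem_nhdsWithin (mem_nhdsWithin_of_mem_nhds (Iic_mem_nhds (by linarith)))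

lemma Prim.add {F f H h : ℝ → ℝ} (hF : Prim F f) (hH : Prim H h) :
    Prim (fun x => F x + H x) (fun x => f x + h x) := by
  intro b hb
  refine ⟨(hF b hb).1.add (hH b hb).1, ?_⟩
  beta_reduce
  rw [intervalIntegral.integral_add (hF b hb).1 (hH b hb).1, (hF b hb).2, (hH b hb).2]; ring

lemma Prim.const_mul {F f : ℝ → ℝ} (hF : Prim F f) (c : ℝ) :
    Prim (fun x => c * F x) (fun x => c * f x) := by
  intro b hb
  refine ⟨(hF b hb).1.const_mul c, ?_⟩
  beta_reduce
  rw [intervalIntegral.integral_const_mul, (hF b hb).2]; ring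

lemma Prim.sub {F f H h : ℝ → ℝ} (hF : Prim F f) (hH : Prim H h) :
    Prim (fun x => F x - H x) (fun x => f x - h x) := by
  intro b hb
  refine ⟨(hF b hb).1.sub (hH b hb).1, ?_⟩
  beta_reduce
  rw [intervalIntegral.integral_sub (hF b hb).1 (hH b hb).1, (hF b hb).2, (hH b hb).2]; ring

lemma Prim.sum {ι : Type*} (s : Finset ι) {F f : ι → ℝ → ℝ} (hF : ∀ i, Prim (F i) (f i)) :
    Prim (fun x => ∑ i ∈ s, F i x) (fun x => ∑ i ∈ s, f i x) := by
  intro b hb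
  refine ⟨by
    have h2 : (fun x => ∑ i ∈ s, f i x) = ∑ i ∈ s, f i := by ext x; simp
    rw [h2]
    exact IntervalIntegrable.sum s (f := f) (fun i _ => ((hF i) b hb).1), ?_⟩
  beta_reduce
  rw [intervalIntegral.integral_finsetSum (fun i _ => ((hF i) b hb).1),
    ← Finset.sum_sub_distrib]
  exact Finset.sum_congr rfl (fun i _ => ((hF i) b hb).2)

lemma ae_uIoc_of_ae {p : ℝ → Prop} (h : ∀ᵐ x ∂(volume.restrict (Ioi (0:ℝ))), p x) (b : ℝ)
    (hb : 0 ≤ b) : ∀ᵐ x ∂(volume.restrict (uIoc 0 b)), p x := by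
  rw [uIoc_of_le hb]
  exact ae_restrict_of_ae_restrict_of_subset (Ioc_subset_Ioi_self) h

lemma Prim.congr_ae {F f h : ℝ → ℝ} (hF : Prim F f)
    (e : ∀ᵐ x ∂(volume.restrict (Ioi (0:ℝ))), f x = h x) : Prim F h := by
  intro b hb
  have e' := ae_uIoc_of_ae e b hb
  refine ⟨(hF b hb).1.congr_ae e', ?_⟩
  rw [← (hF b hb).2]
  refine intervalIntegral.integral_congr_ae ?_
  rw [ae_restrict_iff' measurableSet_uIoc] at e'
  filter_upwards [e'] with x hx hx2 using (hx hx2).symm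

lemma Prim.congr_on {F f h : ℝ → ℝ} (hF : Prim F f) (e : ∀ x, 0 < x → f x = h x) : Prim F h :=
  hF.congr_ae ((ae_restrict_iff' measurableSet_Ioi).2 (ae_of_all _ e))

lemma Prim.congr_left {F H f : ℝ → ℝ} (hF : Prim F f) (e : ∀ x, 0 ≤ x → F x = H x) :
    Prim H f := by
  intro b hb
  refine ⟨(hF b hb).1, ?_⟩
  rw [(hF b hb).2, e b hb, e 0 le_rfl]

lemma Prim.le {F f H h : ℝ → ℝ} (hF : Prim F f) (hH : Prim H h)
    (e : ∀ᵐ x ∂(volume.restrict (Ioi (0:ℝ))), f x ≤ h x) (b : ℝ) (hb : 0 ≤ b) :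
    F b - F 0 ≤ H b - H 0 := by
  rw [← (hF b hb).2, ← (hH b hb).2]
  refine intervalIntegral.integral_mono_ae_restrict hb (hF b hb).1 (hH b hb).1 ?_
  rw [restrict_Ioc_eq_restrict_Icc.symm]
  exact ae_restrict_of_ae_restrict_of_subset (Ioc_subset_Ioi_self) e

lemma Prim.of_integrableOn {f : ℝ → ℝ} (h : IntegrableOn f (Ioi 0)) :
    Prim (fun b => ∫ x in (0:ℝ)..b, f x) f := by
  intro b hb
  refine ⟨?_, by simp⟩
  rw [intervalIntegrable_iff_integrableOn_Ioc_of_le hb]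
  exact h.mono_set Ioc_subset_Ioi_self

lemma Prim.of_continuousOn {f : ℝ → ℝ} (h : ContinuousOn f (Ici 0)) :
    Prim (fun b => ∫ x in (0:ℝ)..b, f x) f := by
  intro b hb
  refine ⟨?_, by simp⟩
  apply ContinuousOn.intervalIntegrable
  rw [uIcc_of_le hb]
  exact h.mono Icc_subset_Ici_self

lemma Prim.of_hasDerivWithinAt {F f : ℝ → ℝ} (hf : ContinuousOn f (Ici 0))
    (h : ∀ x, 0 ≤ x → HasDerivWithinAt F (f x) (Ici 0) x) : Prim F f := by
  intro b hb
  have hi := (Prim.of_continuousOn hf b hb).1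
  refine ⟨hi, ?_⟩
  refine intervalIntegral.integral_eq_sub_of_hasDerivAt_of_le hb ?_ ?_ hi
  · intro x hx
    exact (h x hx.1).continuousWithinAt.mono Icc_subset_Ici_self
  · intro x hx
    exact (h x hx.1.le).hasDerivAt (Ici_mem_nhds hx.1)

lemma Prim.hasDerivAt {F f : ℝ → ℝ} (hF : Prim F f) (hf : ContinuousOn f (Ici 0))
    (x : ℝ) (hx : 0 < x) : HasDerivAt F (f x) x := by
  have hn : Ici (0:ℝ) ∈ 𝓝 x := Ici_mem_nhds hx
  have h1 := intervalIntegral.integral_hasDerivAt_right (hF x hx.le).1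
    (hf.stronglyMeasurableAtFilter_nhdsWithin measurableSet_Ici x |>.filter_mono
      (by rw [nhdsWithin_eq_nhds.2 hn])) (hf.continuousAt hn)
  have h2 := h1.const_add (F 0)
  refine h2.congr_of_eventuallyEq ?_
  filter_upwards [hn] with y hy
  rw [(hF y hy).2]; ring

lemma setIntegral_bound {f : ℝ → ℝ} (hi : IntegrableOn f (Ioi 0)) (h0 : ∀ x, 0 < x → 0 ≤ f x)
    (b : ℝ) (hb : 0 ≤ b) : 0 ≤ ∫ x in (0:ℝ)..b, f x ∧
      ∫ x in (0:ℝ)..b, f x ≤ ∫ x in Ioi (0:ℝ), f x := by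
  rw [intervalIntegral.integral_of_le hb]
  constructor
  · exact setIntegral_nonneg measurableSet_Ioc (fun x hx => h0 x hx.1)
  · refine setIntegral_mono_set hi ?_ (Ioc_subset_Ioi_self).eventuallyLE
    exact (ae_restrict_iff' measurableSet_Ioi).2 (ae_of_all _ (fun x hx => h0 x hx))

lemma boundary {ρ r : ℝ → ℝ} (h : Prim ρ r) (h0 : ∀ x, 0 ≤ x → 0 ≤ ρ x)
    (hi : IntegrableOn ρ (Ioi 0)) (C ε : ℝ) (hC : 0 ≤ C) (hε : 0 < ε) (R0 : ℝ) :
    ∃ R, R0 ≤ R ∧ 0 ≤ R ∧ C * ρ R + r R ≤ ε := by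
  by_contra hcon
  push Not at hcon
  set R1 := max R0 0
  have hR1 : 0 ≤ R1 := le_max_right _ _
  set K := ∫ x in Ioi (0:ℝ), ρ x
  have hQ := ((Prim.of_integrableOn hi).const_mul C).add h
  have hlow : ∀ R, R1 ≤ R → ε * (R - R1) - C * K ≤ ρ R := by
    intro R hR
    have hR0 : 0 ≤ R := hR1.trans hR
    have i1 := (hQ R1 hR1)
    have i2 := (hQ R hR0)
    have i3 := i1.1.symm.trans i2.1
    have e : ∫ x in R1..R, (C * ρ x + r x) = C * (∫ x in (0:ℝ)..R, ρ x) + ρ R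
        - (C * (∫ x in (0:ℝ)..R1, ρ x) + ρ R1) := by
      rw [← intervalIntegral.integral_interval_sub_left i2.1 i1.1, i2.2, i1.2]; ring
    have m : ∫ x in R1..R, ε ≤ ∫ x in R1..R, (C * ρ x + r x) := by
      refine intervalIntegral.integral_mono_on hR (by simp) i3 ?_
      intro x hx
      exact (hcon x ((le_max_left _ _).trans hx.1) (hR1.trans hx.1)).le
    rw [intervalIntegral.integral_const, smul_eq_mul, e] at m
    have b1 := setIntegral_bound hi (fun x hx => h0 x hx.le) R hR0
    have b2 := setIntegral_bound hi (fun x hx => h0 x hx.le) R1 hR1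
    have := h0 R1 hR1
    have c1 := mul_le_mul_of_nonneg_left b1.2 hC
    have c2 := mul_nonneg hC b2.1
    nlinarith
  have hK : 0 ≤ K := setIntegral_nonneg measurableSet_Ioi (fun x hx => h0 x (le_of_lt hx))
  set R2 := R1 + (C * K + 1) / ε
  have hR2 : R1 ≤ R2 := by
    have : 0 ≤ (C * K + 1) / ε := by positivity
    simp only [R2]; linarith
  have hone : IntegrableOn (fun _ : ℝ => (1:ℝ)) (Ioi R2) := by
    refine Integrable.mono' (hi.mono_set (Ioi_subset_Ioi (hR1.trans hR2))) (by fun_prop) ?_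
    refine (ae_restrict_iff' measurableSet_Ioi).2 (ae_of_all _ (fun x hx => ?_))
    have hx' : R2 < x := hx
    have := hlow x (hR2.trans hx'.le)
    have h2 : ε * (R2 - R1) = C * K + 1 := by simp only [R2]; field_simp; ring
    have h3 := mul_le_mul_of_nonneg_left (sub_le_sub_right hx'.le R1) hε.le
    simp only [norm_one]; linarith
  simp at hone

structure Sys (G V : ℝ → ℝ) (τ : ℝ) (f g : ℝ → ℝ) : Prop where
  hf : Prim f (fun x => g x + G x * f x)
  hg : Prim g (fun x => (τ - V x) * f x - G x * g x)
  g0 : g 0 = 0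
  L2 : IntegrableOn (fun x => f x ^ 2) (Ioi 0)

lemma Sys.fg {G V τ f g} (S : Sys G V τ f g) :
    Prim (fun x => f x * g x) (fun x => g x ^ 2 + (τ - V x) * f x ^ 2) :=
  (S.hf.mul S.hg).congr_on (fun x _ => by ring)

lemma Sys.fsq {G V τ f g} (S : Sys G V τ f g) :
    Prim (fun x => f x ^ 2) (fun x => 2 * (f x * g x + G x * f x ^ 2)) :=
  ((S.hf.mul S.hf).congr_on (fun x _ => by ring)).congr_left (fun x _ => by ring)

lemma Sys.smul {G V τ f g} (S : Sys G V τ f g) (c : ℝ) :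
    Sys G V τ (fun x => c * f x) (fun x => c * g x) where
  hf := (S.hf.const_mul c).congr_on (fun x _ => by ring)
  hg := (S.hg.const_mul c).congr_on (fun x _ => by ring)
  g0 := by simp [S.g0]
  L2 := by
    have := S.L2.const_mul (c ^ 2)
    refine this.congr (ae_of_all _ (fun x => ?_))
    simp only; ring

lemma Sys.gL2 {G V : ℝ → ℝ} {τ s : ℝ} {f g : ℝ → ℝ} (S : Sys G V τ f g) (hs : 0 ≤ s)
    (hG : ∀ x, 0 ≤ x → -s ≤ G x)
    (hV : IntegrableOn (fun r => (max (V r) 0) ^ 2) (Ioi 0)) :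
    IntegrableOn (fun x => g x ^ 2) (Ioi 0) := by
  set M : ℝ → ℝ := fun b => ∫ x in (0:ℝ)..b, f x ^ 2 with hM
  set K := ∫ x in Ioi (0:ℝ), f x ^ 2 with hK
  set U : ℝ → ℝ := fun b => ∫ x in (0:ℝ)..b, (max (V x) 0) ^ 2 with hU
  set KV := ∫ x in Ioi (0:ℝ), (max (V x) 0) ^ 2 with hKV
  have pM : Prim M (fun x => f x ^ 2) := Prim.of_integrableOn S.L2
  have pU : Prim U (fun x => (max (V x) 0) ^ 2) := Prim.of_integrableOn hV
  have bM : ∀ b, 0 ≤ b → 0 ≤ M b ∧ M b ≤ K := fun b hb =>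
    setIntegral_bound S.L2 (fun x _ => sq_nonneg _) b hb
  have bU : ∀ b, 0 ≤ b → 0 ≤ U b ∧ U b ≤ KV := fun b hb =>
    setIntegral_bound hV (fun x _ => sq_nonneg _) b hb
  have hK0 : 0 ≤ K := (bM 0 le_rfl).1.trans (bM 0 le_rfl).2
  have cg := S.hg.continuousOn
  have pg : Prim (fun b => ∫ x in (0:ℝ)..b, g x ^ 2) (fun x => g x ^ 2) :=
    Prim.of_continuousOn (cg.pow 2)
  have pA := pg.const_mul (1/2)
  have pB := ((S.fg.add (pM.mul S.fsq)).add (pU.const_mul (1/4))).add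
    (pM.const_mul (|τ| + 2 * K ^ 2 + 2 * s * K))
  have main := pA.le pB (by
    refine (ae_restrict_iff' measurableSet_Ioi).2 (ae_of_all _ (fun x hx => ?_))
    have hx0 : 0 ≤ x := le_of_lt hx
    obtain ⟨m0, m1⟩ := bM x hx0
    have hg' := hG x hx0
    have e1 : V x * f x ^ 2 ≤ (max (V x) 0)^2 / 4 + f x ^ 2 * f x ^ 2 := by
      have := mul_le_mul_of_nonneg_right (le_max_left (V x) 0) (sq_nonneg (f x))
      nlinarith [sq_nonneg (max (V x) 0 / 2 - f x ^ 2)]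
    have e2 : - τ * f x ^ 2 ≤ |τ| * f x ^ 2 :=
      mul_le_mul_of_nonneg_right (neg_le_abs τ) (sq_nonneg _)
    have e3 : 0 ≤ (1/2) * g x ^ 2 + 2 * M x * (f x * g x) + 2 * K ^ 2 * f x ^ 2 := by
      have : M x ^ 2 * f x ^ 2 ≤ K ^ 2 * f x ^ 2 := by gcongr
      nlinarith [sq_nonneg (g x + 2 * M x * f x)]
    have e4 : 0 ≤ 2 * M x * (G x * f x ^ 2) + 2 * s * K * f x ^ 2 := by
      have a1 : 0 ≤ M x * f x ^ 2 * (G x + s) :=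
        mul_nonneg (mul_nonneg m0 (sq_nonneg _)) (by linarith)
      have a2 : 0 ≤ (K - M x) * f x ^ 2 * s :=
        mul_nonneg (mul_nonneg (by linarith) (sq_nonneg _)) hs
      nlinarith
    nlinarith)
  have hb := fun n : ℕ => boundary S.fsq (fun x _ => sq_nonneg _) S.L2 (2 * (s + K)) 2
    (by positivity) (by norm_num) n
  choose R hR1 hR2 hR3 using hb
  have hlim : Tendsto R atTop atTop := tendsto_atTop_mono hR1 tendsto_natCast_atTop_atTop
  refine integrableOn_Ioi_of_intervalIntegral_norm_bounded (l := atTop) (b := R)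
    (2 * (1 + KV / 4 + (|τ| + 2 * K ^ 2 + 2 * s * K) * K)) 0 ?_ hlim ?_
  · intro n
    exact (intervalIntegrable_iff_integrableOn_Ioc_of_le (hR2 n)).1 (pg _ (hR2 n)).1
  · refine Eventually.of_forall (fun n => ?_)
    have h1 := main (R n) (hR2 n)
    have h2 := hR3 n
    have h3 := hG _ (hR2 n)
    obtain ⟨m0, m1⟩ := bM _ (hR2 n)
    obtain ⟨u0, u1⟩ := bU _ (hR2 n)
    simp only [Real.norm_eq_abs, abs_pow, sq_abs]
    have z1 : M 0 = 0 := by simp [hM]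
    have z2 : U 0 = 0 := by simp [hU]
    simp only [z1, z2, S.g0, intervalIntegral.integral_same] at h1
    have c1 : (|τ| + 2 * K ^ 2 + 2 * s * K) * M (R n) ≤ (|τ| + 2 * K ^ 2 + 2 * s * K) * K := by
      gcongr
    have c2 : M (R n) * f (R n) ^ 2 ≤ K * f (R n) ^ 2 := by gcongr
    have c3 : 0 ≤ (G (R n) + s) * f (R n) ^ 2 := mul_nonneg (by linarith) (sq_nonneg _)
    nlinarith

lemma integrableOn_mul_of_sq {f g : ℝ → ℝ} (cf : ContinuousOn f (Ici 0))
    (cg : ContinuousOn g (Ici 0)) (hf : IntegrableOn (fun x => f x ^ 2) (Ioi 0))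
    (hg : IntegrableOn (fun x => g x ^ 2) (Ioi 0)) :
    IntegrableOn (fun x => f x * g x) (Ioi 0) := by
  refine Integrable.mono' (hf.add hg) ?_ (ae_of_all _ (fun x => ?_))
  · exact ((cf.mul cg).mono Ioi_subset_Ici_self).aestronglyMeasurable measurableSet_Ioi
  · simp only [Real.norm_eq_abs, Pi.add_apply, abs_mul]
    nlinarith [sq_nonneg (|f x| - |g x|), sq_abs (f x), sq_abs (g x), sq_nonneg (f x),
      sq_nonneg (g x)]

lemma Sys.orth {G V : ℝ → ℝ} {τ₁ τ₂ s : ℝ} {f₁ g₁ f₂ g₂ : ℝ → ℝ} (S₁ : Sys G V τ₁ f₁ g₁)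
    (S₂ : Sys G V τ₂ f₂ g₂) (hs : 0 ≤ s)
    (hG : ∀ x, 0 ≤ x → -s ≤ G x)
    (hV : IntegrableOn (fun r => (max (V r) 0) ^ 2) (Ioi 0)) (hne : τ₁ ≠ τ₂) :
    ∫ x in Ioi (0:ℝ), f₁ x * f₂ x = 0 := by
  have G₁ := S₁.gL2 hs hG hV
  have G₂ := S₂.gL2 hs hG hV
  have cf₁ := S₁.hf.continuousOn
  have cf₂ := S₂.hf.continuousOn
  have cg₁ := S₁.hg.continuousOn
  have cg₂ := S₂.hg.continuousOn
  have pw : Prim (fun x => f₁ x * g₂ x - f₂ x * g₁ x) (fun x => (τ₂ - τ₁) * (f₁ x * f₂ x)) :=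
    ((S₁.hf.mul S₂.hg).sub (S₂.hf.mul S₁.hg)).congr_on (fun x _ => by ring)
  have iff := integrableOn_mul_of_sq cf₁ cf₂ S₁.L2 S₂.L2
  have iw : IntegrableOn (fun x => f₁ x * g₂ x - f₂ x * g₁ x) (Ioi 0) :=
    (integrableOn_mul_of_sq cf₁ cg₂ S₁.L2 G₂).sub (integrableOn_mul_of_sq cf₂ cg₁ S₂.L2 G₁)
  have t0 := tendsto_zero_of_hasDerivAt_of_integrableOn_Ioi
    (fun x hx => pw.hasDerivAt ((cf₁.mul cf₂).const_mul (τ₂ - τ₁)) x hx)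
    (iff.const_mul (τ₂ - τ₁)) iw
  have t1 := (intervalIntegral_tendsto_integral_Ioi 0 iff tendsto_id).const_mul (τ₂ - τ₁)
  have t2 : Tendsto (fun x => f₁ x * g₂ x - f₂ x * g₁ x) atTop
      (𝓝 ((τ₂ - τ₁) * ∫ x in Ioi (0:ℝ), f₁ x * f₂ x)) := by
    refine t1.congr' ?_
    filter_upwards [eventually_ge_atTop 0] with x hx
    have := (pw x hx).2
    rw [intervalIntegral.integral_const_mul] at this
    simp only [id, this, S₁.g0, S₂.g0]; ring
  have := tendsto_nhds_unique t2 t0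
  rcases mul_eq_zero.1 this with h | h
  · exact absurd (by linarith) hne
  · exact h

lemma algA {N : ℕ} (f g : Fin N → ℝ) (G : ℝ) (m : Fin N → Fin N → ℝ)
    (hm : ∀ i j, m i j = m j i) :
    ∑ i, ∑ j, (((g i + G * f i) * f j + f i * (g j + G * f j)) * m i j
        + f i * f j * (f i * f j))
      = 2 * ∑ i, g i * (∑ j, m i j * f j) + 2 * G * (∑ i, ∑ j, f i * f j * m i j)
        + (∑ i, f i ^ 2) ^ 2 := by
  have h1 : ∑ i, g i * (∑ j, m i j * f j) = ∑ i, ∑ j, g i * f j * m i j := by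
    refine Finset.sum_congr rfl (fun i _ => ?_)
    rw [Finset.mul_sum]
    exact Finset.sum_congr rfl (fun j _ => by ring)
  have h2 : ∑ i, ∑ j, g i * f j * m i j = ∑ i, ∑ j, f i * g j * m i j := by
    rw [Finset.sum_comm]
    refine Finset.sum_congr rfl (fun i _ => Finset.sum_congr rfl (fun j _ => ?_))
    rw [hm]; ring
  have h3 : (∑ i, f i ^ 2) ^ 2 = ∑ i, ∑ j, f i * f j * (f i * f j) := by
    rw [sq, Finset.sum_mul_sum]
    exact Finset.sum_congr rfl (fun i _ => Finset.sum_congr rfl (fun j _ => by ring))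
  rw [h3, two_mul (∑ i, g i * (∑ j, m i j * f j))]
  nth_rewrite 2 [h1]
  rw [h2, h1, Finset.mul_sum]
  simp only [Finset.mul_sum, ← Finset.sum_add_distrib]
  exact Finset.sum_congr rfl (fun i _ => Finset.sum_congr rfl (fun j _ => by ring))

lemma algC {N : ℕ} (f : Fin N → ℝ) (m : Fin N → Fin N → ℝ)
    (hm : ∀ i j, m i j = m j i) :
    ∑ i, ∑ j, ∑ k, ((f i * f j * m j k + m i j * (f j * f k)) * m k i
        + m i j * m j k * (f k * f i))
      = 3 * ∑ i, (∑ j, m i j * f j) ^ 2 := by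
  have e : ∀ i, (∑ j, m i j * f j) ^ 2 = ∑ j, ∑ k, m i j * f j * (m i k * f k) := by
    intro i; rw [sq, Finset.sum_mul_sum]
  have h1 : ∑ i, ∑ j, ∑ k, f i * f j * m j k * m k i = ∑ i, (∑ j, m i j * f j) ^ 2 := by
    simp_rw [e]
    have : ∀ i : Fin N, ∑ j, ∑ k, f i * f j * m j k * m k i
        = ∑ k, ∑ j, f i * f j * m j k * m k i := fun i => Finset.sum_comm
    simp_rw [this]
    rw [Finset.sum_comm]
    refine Finset.sum_congr rfl (fun i _ => Finset.sum_congr rfl (fun j _ =>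
      Finset.sum_congr rfl (fun k _ => ?_)))
    rw [hm k i]; ring
  have h2 : ∑ i, ∑ j, ∑ k, m i j * (f j * f k) * m k i = ∑ i, (∑ j, m i j * f j) ^ 2 := by
    simp_rw [e]
    refine Finset.sum_congr rfl (fun i _ => Finset.sum_congr rfl (fun j _ =>
      Finset.sum_congr rfl (fun k _ => ?_)))
    rw [hm k i]; ring
  have h3 : ∑ i, ∑ j, ∑ k, m i j * m j k * (f k * f i) = ∑ i, (∑ j, m i j * f j) ^ 2 := by
    simp_rw [e]
    rw [Finset.sum_comm]
    refine Finset.sum_congr rfl (fun i _ => Finset.sum_congr rfl (fun j _ =>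
      Finset.sum_congr rfl (fun k _ => ?_)))
    rw [hm j i]; ring
  have h4 : (3:ℝ) * ∑ i, (∑ j, m i j * f j) ^ 2 = ∑ i, (∑ j, m i j * f j) ^ 2
    + ∑ i, (∑ j, m i j * f j) ^ 2 + ∑ i, (∑ j, m i j * f j) ^ 2 := by ring
  rw [h4]
  nth_rewrite 1 [← h1]
  nth_rewrite 1 [← h2]
  rw [← h3]
  simp only [← Finset.sum_add_distrib]
  exact Finset.sum_congr rfl (fun i _ => Finset.sum_congr rfl (fun j _ =>
      Finset.sum_congr rfl (fun k _ => by ring)))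

lemma algB {N : ℕ} (f : Fin N → ℝ) (m : Fin N → Fin N → ℝ) :
    ∑ i, f i * (∑ j, m i j * f j) = ∑ i, ∑ j, f i * f j * m i j := by
  refine Finset.sum_congr rfl (fun i _ => ?_)
  rw [Finset.mul_sum]
  exact Finset.sum_congr rfl (fun j _ => by ring)

lemma pointwise_ineq {N : ℕ} (f g τ : Fin N → ℝ) (G V s : ℝ) (m : Fin N → Fin N → ℝ)
    (hm : ∀ i j, m i j = m j i) (hG : -s ≤ G) (hpos : 0 ≤ ∑ i, ∑ j, f i * f j * m i j) :
    -(1/4) * (max V 0) ^ 2 ≤ ∑ i, (g i ^ 2 + (τ i - V) * f i ^ 2)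
      + ∑ i, ∑ j, (((g i + G * f i) * f j + f i * (g j + G * f j)) * m i j
        + f i * f j * (f i * f j))
      + s * ∑ i, ∑ j, (f i * f j * m i j + m i j * (f i * f j))
      + (1/3) * ∑ i, ∑ j, ∑ k, ((f i * f j * m j k + m i j * (f j * f k)) * m k i
        + m i j * m j k * (f k * f i))
      - ∑ i, τ i * (f i * f i) := by
  rw [algA f g G m hm, algC f m hm]
  have h1 : ∑ i, ∑ j, (f i * f j * m i j + m i j * (f i * f j))
      = 2 * ∑ i, ∑ j, f i * f j * m i j := by
    simp only [Finset.mul_sum]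
    exact Finset.sum_congr rfl (fun i _ => Finset.sum_congr rfl (fun j _ => by ring))
  rw [h1]
  have h2 : ∑ i, (g i ^ 2 + (τ i - V) * f i ^ 2) = ∑ i, g i ^ 2 + ∑ i, τ i * (f i * f i)
      - V * ∑ i, f i ^ 2 := by
    rw [Finset.mul_sum, ← Finset.sum_add_distrib, ← Finset.sum_sub_distrib]
    exact Finset.sum_congr rfl (fun i _ => by ring)
  rw [h2]
  have h3 : 0 ≤ ∑ i, g i ^ 2 + 2 * ∑ i, g i * (∑ j, m i j * f j)
      + ∑ i, (∑ j, m i j * f j) ^ 2 := by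
    have : ∑ i, g i ^ 2 + 2 * ∑ i, g i * (∑ j, m i j * f j)
      + ∑ i, (∑ j, m i j * f j) ^ 2 = ∑ i, (g i + ∑ j, m i j * f j) ^ 2 := by
      rw [Finset.mul_sum, ← Finset.sum_add_distrib, ← Finset.sum_add_distrib]
      exact Finset.sum_congr rfl (fun i _ => by ring)
    rw [this]
    positivity
  have h4 : 0 ≤ ∑ i, f i ^ 2 := by positivity
  set ρ := ∑ i, f i ^ 2
  have h5 : V * ρ ≤ max V 0 * ρ := mul_le_mul_of_nonneg_right (le_max_left _ _) h4
  have h6 : 0 ≤ (G + s) * ∑ i, ∑ j, f i * f j * m i j := mul_nonneg (by linarith) hpos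
  nlinarith [sq_nonneg (max V 0 / 2 - ρ)]

lemma core {N : ℕ} {G V : ℝ → ℝ} {s : ℝ} {τ d : Fin N → ℝ} {f g : Fin N → ℝ → ℝ}
    (S : ∀ i, Sys G V (τ i) (f i) (g i)) (hs : 0 ≤ s)
    (hG : ∀ x, 0 ≤ x → -s ≤ G x)
    (hV : IntegrableOn (fun r => (max (V r) 0) ^ 2) (Ioi 0))
    (hd : ∀ i j, ∫ x in Ioi (0:ℝ), f i x * f j x = if i = j then d i else 0) :
    ∑ i, (d i * τ i - d i ^ 3 / 3 - s * d i ^ 2)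
      ≤ 1 / 4 * ∫ x in Ioi (0:ℝ), (max (V x) 0) ^ 2 := by
  have cf := fun i => (S i).hf.continuousOn
  have iff := fun i j => integrableOn_mul_of_sq (cf i) (cf j) (S i).L2 (S j).L2
  set M : Fin N → Fin N → ℝ → ℝ := fun i j b => ∫ x in (0:ℝ)..b, f i x * f j x with hM
  have pM : ∀ i j, Prim (M i j) (fun x => f i x * f j x) := fun i j =>
    Prim.of_integrableOn (iff i j)
  have M0 : ∀ i j, M i j 0 = 0 := fun i j => by simp [hM]
  have symM : ∀ x i j, M i j x = M j i x := fun x i j => by simp only [hM, mul_comm]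
  set U : ℝ → ℝ := fun b => ∫ x in (0:ℝ)..b, (max (V x) 0) ^ 2 with hU
  set KV := ∫ x in Ioi (0:ℝ), (max (V x) 0) ^ 2 with hKV
  have pU : Prim U (fun x => (max (V x) 0) ^ 2) := Prim.of_integrableOn hV
  have bU : ∀ b, 0 ≤ b → 0 ≤ U b ∧ U b ≤ KV := fun b hb =>
    setIntegral_bound hV (fun x _ => sq_nonneg _) b hb
  -- density
  have iρ : IntegrableOn (fun x => ∑ i, f i x ^ 2) (Ioi 0) :=
    integrable_finsetSum _ (fun i _ => (S i).L2)
  have pρ : Prim (fun x => ∑ i, f i x ^ 2)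
      (fun x => ∑ i, 2 * (f i x * g i x + G x * f i x ^ 2)) :=
    Prim.sum _ (fun i => (S i).fsq)
  set K := ∫ x in Ioi (0:ℝ), ∑ i, f i x ^ 2 with hK
  have hK0 : 0 ≤ K := setIntegral_nonneg measurableSet_Ioi (fun x _ => by positivity)
  -- quadratic form of `M`
  have quad : ∀ x, 0 ≤ x → 0 ≤ ∑ i, ∑ j, f i x * f j x * M i j x ∧
      ∑ i, ∑ j, f i x * f j x * M i j x ≤ K * ∑ i, f i x ^ 2 := by
    intro x hx
    have ii : ∀ i j, IntervalIntegrable (fun y => f i x * f j x * (f i y * f j y)) volume 0 x :=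
      fun i j => ((pM i j) x hx).1.const_mul _
    have e : ∑ i, ∑ j, f i x * f j x * M i j x
        = ∫ y in (0:ℝ)..x, (∑ i, f i x * f i y) ^ 2 := by
      have e1 : ∀ y, (∑ i, f i x * f i y) ^ 2 = ∑ i, ∑ j, f i x * f j x * (f i y * f j y) := by
        intro y
        rw [sq, Finset.sum_mul_sum]
        exact Finset.sum_congr rfl (fun i _ => Finset.sum_congr rfl (fun j _ => by ring))
      simp_rw [e1]
      rw [intervalIntegral.integral_finsetSum]
      · refine Finset.sum_congr rfl (fun i _ => ?_)
        rw [intervalIntegral.integral_finsetSum (fun j _ => ii i j)]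
        exact Finset.sum_congr rfl (fun j _ => by
          rw [intervalIntegral.integral_const_mul])
      · intro i _
        have h2 : (fun y => ∑ j, f i x * f j x * (f i y * f j y))
          = ∑ j, fun y => f i x * f j x * (f i y * f j y) := by ext y; simp
        rw [h2]
        exact IntervalIntegrable.sum _ (fun j _ => ii i j)
    rw [e]
    constructor
    · exact intervalIntegral.integral_nonneg hx (fun y _ => sq_nonneg _)
    · have cc : ContinuousOn (fun y => (∑ i, f i x * f i y) ^ 2) (Ici 0) :=
        (continuousOn_finsetSum _ (fun i _ => (cf i).const_mul (f i x))).pow 2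
      have b1 := (setIntegral_bound iρ (fun x _ => by positivity) x hx).2
      calc ∫ y in (0:ℝ)..x, (∑ i, f i x * f i y) ^ 2
          ≤ ∫ y in (0:ℝ)..x, (∑ i, f i x ^ 2) * ∑ i, f i y ^ 2 := by
            refine intervalIntegral.integral_mono_on hx ((Prim.of_continuousOn cc) x hx).1
              ((pρ.continuousOn.mono ?_).intervalIntegrable.const_mul _) ?_
            · rw [uIcc_of_le hx]; exact Icc_subset_Ici_self
            · intro y _
              exact Finset.sum_mul_sq_le_sq_mul_sq _ _ _
        _ = (∑ i, f i x ^ 2) * ∫ y in (0:ℝ)..x, ∑ i, f i y ^ 2 := by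
            rw [intervalIntegral.integral_const_mul]
        _ ≤ (∑ i, f i x ^ 2) * K := by gcongr
        _ = _ := mul_comm _ _
  have pT : Prim (fun x => ∑ i, f i x * g i x)
      (fun x => ∑ i, (g i x ^ 2 + (τ i - V x) * f i x ^ 2)) := Prim.sum _ (fun i => (S i).fg)
  have pA := Prim.sum Finset.univ (fun i : Fin N => Prim.sum Finset.univ (fun j : Fin N =>
    ((S i).hf.mul (S j).hf).mul (pM i j)))
  have pB := Prim.sum Finset.univ (fun i : Fin N => Prim.sum Finset.univ (fun j : Fin N =>
    (pM i j).mul (pM i j)))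
  have pC := Prim.sum Finset.univ (fun i : Fin N => Prim.sum Finset.univ (fun j : Fin N =>
    Prim.sum Finset.univ (fun k : Fin N => ((pM i j).mul (pM j k)).mul (pM k i))))
  have pD := Prim.sum Finset.univ (fun i : Fin N => (pM i i).const_mul (τ i))
  have pAll := (((pT.add pA).add (pB.const_mul s)).add (pC.const_mul (1/3))).sub pD
  have main := (pU.const_mul (-(1/4))).le pAll (by
    refine (ae_restrict_iff' measurableSet_Ioi).2 (ae_of_all _ (fun x hx => ?_))
    have hx0 : 0 ≤ x := le_of_lt hx
    exact pointwise_ineq (fun i => f i x) (fun i => g i x) τ (G x) (V x) s (fun i j => M i j x)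
      (symM x) (hG x hx0) (quad x hx0).1)
  set L : ℝ → ℝ := fun x => ∑ i, τ i * M i i x
    - (1/3) * (∑ i, ∑ j, ∑ k, M i j x * M j k x * M k i x)
    - s * (∑ i, ∑ j, M i j x * M i j x) with hL
  have tM : ∀ i j, Tendsto (M i j) atTop (𝓝 (if i = j then d i else 0)) := by
    intro i j
    rw [← hd i j]
    exact intervalIntegral_tendsto_integral_Ioi 0 (iff i j) tendsto_id
  have tL : Tendsto L atTop (𝓝 (∑ i, (d i * τ i - d i ^ 3 / 3 - s * d i ^ 2))) := by
    have := ((tendsto_finsetSum Finset.univ (fun i _ => (tM i i).const_mul (τ i))).sub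
      ((tendsto_finsetSum Finset.univ (fun i _ => tendsto_finsetSum Finset.univ (fun j _ =>
        tendsto_finsetSum Finset.univ
          (fun k _ => ((tM i j).mul (tM j k)).mul (tM k i))))).const_mul (1/3))).sub
      ((tendsto_finsetSum Finset.univ (fun i _ => tendsto_finsetSum Finset.univ (fun j _ =>
          ((tM i j).mul (tM i j))))).const_mul s)
    convert this using 2
    simp only [ite_mul, mul_ite, zero_mul, mul_zero, Finset.sum_ite_eq, Finset.sum_ite_eq',
      Finset.mem_univ, if_true, Finset.mul_sum, ← Finset.sum_sub_distrib]
    refine Finset.sum_congr rfl (fun i _ => ?_)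
    ring
  refine le_of_forall_pos_le_add (fun ε hε => ?_)
  have hb := fun n : ℕ => boundary pρ (fun x _ => by positivity) iρ (2 * (s + K)) (2 * ε)
    (by positivity) (by positivity) n
  choose R hR1 hR2 hR3 using hb
  have hlim : Tendsto R atTop atTop := tendsto_atTop_mono hR1 tendsto_natCast_atTop_atTop
  refine le_of_tendsto' (tL.comp hlim) (fun n => ?_)
  have h1 := main (R n) (hR2 n)
  have h2 := hR3 n
  have h3 := hG _ (hR2 n)
  obtain ⟨u0, u1⟩ := bU _ (hR2 n)
  have h4 := (quad _ (hR2 n)).2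
  have z2 : U 0 = 0 := by simp [hU]
  simp only [z2, M0, (S _).g0, mul_zero, Finset.sum_const_zero] at h1
  have e5 : ∑ i, 2 * (f i (R n) * g i (R n) + G (R n) * f i (R n) ^ 2)
      = 2 * (∑ i, f i (R n) * g i (R n)) + 2 * G (R n) * ∑ i, f i (R n) ^ 2 := by
    simp only [Finset.mul_sum, ← Finset.sum_add_distrib]
    exact Finset.sum_congr rfl (fun i _ => by ring)
  rw [e5] at h2
  have h6 : 0 ≤ (G (R n) + s) * ∑ i, f i (R n) ^ 2 := mul_nonneg (by linarith) (by positivity)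
  simp only [hL, Function.comp]
  nlinarith

lemma Prim.anti {F f : ℝ → ℝ} (hF : Prim F f) (a : ℝ) (ha : 0 ≤ a)
    (e : ∀ᵐ x ∂(volume.restrict (Ioi (0:ℝ))), a < x → f x ≤ 0) (b : ℝ) (hab : a ≤ b) :
    F b ≤ F a := by
  have i1 := hF a ha
  have i2 := hF b (ha.trans hab)
  have e1 : ∫ x in a..b, f x = F b - F a := by
    rw [← intervalIntegral.integral_interval_sub_left i2.1 i1.1, i2.2, i1.2]; ring
  have e2 : ∫ x in a..b, f x ≤ 0 := by
    rw [intervalIntegral.integral_of_le hab]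
    refine setIntegral_nonpos_of_ae_restrict ?_
    have h1 : ∀ᵐ x ∂(volume.restrict (Ioc a b)), a < x → f x ≤ 0 :=
      ae_restrict_of_ae_restrict_of_subset (fun x hx => lt_of_le_of_lt ha hx.1) e
    filter_upwards [h1, ae_restrict_mem measurableSet_Ioc] with x hx hx2 using hx hx2.1
  linarith

lemma ground_lower {u p q V₀ : ℝ → ℝ} {s : ℝ} (hs : 0 ≤ s) (hu : Prim u p) (hp : Prim p q)
    (pos : ∀ x, 0 ≤ x → 0 < u x) (hV : ∀ x ∈ Ioi (0:ℝ), 0 ≤ V₀ x)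
    (e : ∀ᵐ x ∂(volume.restrict (Ioi (0:ℝ))), q x = (s ^ 2 - V₀ x) * u x) (r : ℝ) (hr : 0 ≤ r) :
    0 ≤ p r + s * u r := by
  by_contra hcon
  push Not at hcon
  have pE : ∀ t : ℝ, Prim (fun x => Real.exp (t * x)) (fun x => t * Real.exp (t * x)) := by
    intro t
    refine Prim.of_hasDerivWithinAt (by fun_prop) (fun x _ => ?_)
    have h1 : HasDerivAt (fun x => t * x) t x := by simpa using (hasDerivAt_id x).const_mul t
    have := h1.exp.hasDerivWithinAt (s := Ici 0)
    rwa [mul_comm] at this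
  have ph := (hp.add (hu.const_mul s)).mul (pE (-s))
  have k1 := fun x hx => ph.anti r hr (by
    filter_upwards [e, ae_restrict_mem measurableSet_Ioi] with x hx hx0 _
    rw [hx]
    have a1 : 0 ≤ V₀ x * u x * Real.exp (-s * x) :=
      mul_nonneg (mul_nonneg (hV x hx0) (pos x (le_of_lt hx0)).le) (Real.exp_pos _).le
    nlinarith) x hx
  set c := -((p r + s * u r) * Real.exp (-s * r)) with hc
  have hc0 : 0 < c := by
    have := mul_neg_of_neg_of_pos hcon (Real.exp_pos (-s * r))
    linarith
  have pid : Prim (fun x : ℝ => x) (fun _ => 1) :=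
    Prim.of_hasDerivWithinAt (by fun_prop) (fun x _ => hasDerivWithinAt_id x _)
  have k2 := fun x hx => ((hu.mul (pE s)).add (pid.const_mul c)).anti r hr (by
    filter_upwards [ae_restrict_mem measurableSet_Ioi] with x hx0 hx
    have b1 := k1 x hx.le
    have hx0' : (0:ℝ) < x := hx0
    have b2 : (p x + s * u x) * Real.exp (-s * x) ≤ -c := by simp only [hc]; linarith
    have b3 : Real.exp (-s * x) * Real.exp (s * x) = 1 := by
      rw [← Real.exp_add]; simp
    have b4 : 1 ≤ Real.exp (s * x) := Real.one_le_exp (by positivity)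
    set w := Real.exp (s * x)
    set v := Real.exp (-s * x)
    have b5 : (p x + s * u x) * w = ((p x + s * u x) * v) * (w * w) := by
      calc (p x + s * u x) * w = (p x + s * u x) * (v * w) * w := by rw [b3]; ring
        _ = _ := by ring
    have b6 : ((p x + s * u x) * v) * (w * w) ≤ -c * (w * w) :=
      mul_le_mul_of_nonneg_right b2 (by positivity)
    have b7 : 1 ≤ w * w := by nlinarith
    nlinarith) x hx
  set B := u r * Real.exp (s * r) + c * r with hB
  set X := max r (B / c) with hX
  have h1 := k2 X (le_max_left _ _)
  have h2 : B ≤ c * X := by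
    have : B / c ≤ X := le_max_right _ _
    rw [div_le_iff₀ hc0] at this; linarith
  have h3 : 0 < u X * Real.exp (s * X) :=
    mul_pos (pos X (hr.trans (le_max_left _ _))) (Real.exp_pos _)
  linarith

lemma prim_of_contDiffOn {ψ : ℝ → ℝ} (h : ContDiffOn ℝ 1 ψ (Ici 0)) :
    Prim ψ (derivWithin ψ (Ici 0)) := by
  refine Prim.of_hasDerivWithinAt (h.continuousOn_derivWithin (uniqueDiffOn_Ici 0) le_rfl) ?_
  intro x hx
  exact (h.differentiableOn one_ne_zero x hx).hasDerivWithinAt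

theorem robin_sum_dist_first_eigenvalue_le
    (σ : ℝ) (V₀ V : ℝ → ℝ)
    (hV₀nonneg : ∀ r ∈ Set.Ioi (0 : ℝ), 0 ≤ V₀ r)
    (hV₀mono : AntitoneOn V₀ (Set.Ioi 0))
    (hV₀int : IntegrableOn V₀ (Set.Ioi 0) volume)
    (hVmeas : Measurable V)
    (hVplus : MemLp (fun r => max (V r) 0) 2 (volume.restrict (Set.Ioi (0 : ℝ))))
    (μ₁ : ℝ) (hμ₁ : 0 < μ₁)
    (hground : IsRobinEigenvalueWithPositiveEigenfunction σ V₀ (-μ₁))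
    (N : ℕ) (E : Fin N → ℝ)
    (hEneg : ∀ k, E k < 0)
    (hEdist : Function.Injective E)
    (hEeig : ∀ k, IsRobinEigenvalue σ (fun r => V₀ r + V r) (E k)) :
    ∑ k : Fin N, max (Real.sqrt |E k| - Real.sqrt μ₁) 0 ^ 3
      ≤ 3 / 8 * ∫ r in Set.Ioi (0 : ℝ), (max (V r) 0) ^ 2 := by
  obtain ⟨u, u2, upos, -, uC, u2i, ubc, ueq⟩ := hground
  have hV : IntegrableOn (fun r => (max (V r) 0) ^ 2) (Ioi 0) := hVplus.integrable_sq
  set s := Real.sqrt μ₁ with hs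
  have hs0 : 0 ≤ s := Real.sqrt_nonneg _
  have hs2 : s ^ 2 = μ₁ := Real.sq_sqrt hμ₁.le
  set p := derivWithin u (Ici 0) with hp
  have pu : Prim u p := prim_of_contDiffOn uC
  have pp : Prim p u2 := fun b hb => u2i 0 b le_rfl hb
  have upos' : ∀ x, 0 ≤ x → 0 < u x := fun x hx => upos x hx
  have hlow := ground_lower (V₀ := V₀) hs0 pu pp upos' hV₀nonneg (by
    filter_upwards [ueq] with x hx
    rw [hs2]; linarith)
  set G : ℝ → ℝ := fun x => p x * (u x)⁻¹ with hGdef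
  have hG : ∀ x, 0 ≤ x → -s ≤ G x := by
    intro x hx
    have := hlow x hx
    simp only [hGdef, ← div_eq_mul_inv]
    rw [le_div_iff₀ (upos' x hx)]; linarith
  have pinv : Prim (fun x => (u x)⁻¹) (fun x => -p x / u x ^ 2) := by
    refine Prim.of_hasDerivWithinAt ?_ ?_
    · exact pp.continuousOn.neg.div (pu.continuousOn.pow 2)
        (fun x hx => pow_ne_zero _ (upos x hx).ne')
    · intro x hx
      exact (uC.differentiableOn one_ne_zero x hx).hasDerivWithinAt.fun_inv (upos x hx).ne'
  have pG : Prim G (fun x => μ₁ - V₀ x - G x ^ 2) := by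
    refine (pp.mul pinv).congr_ae ?_
    filter_upwards [ueq, ae_restrict_mem measurableSet_Ioi] with x hx hx0
    have h1 := (upos' x (le_of_lt hx0)).ne'
    have h2 : u2 x = (μ₁ - V₀ x) * u x := by linarith
    simp only [hGdef]
    rw [h2]; field_simp; ring
  have G0 : G 0 = σ := by
    have h1 := (upos' 0 le_rfl).ne'
    have : p 0 = σ * u 0 := by linarith
    simp only [hGdef, this]; field_simp
  have hsys : ∀ k, ∃ f g : ℝ → ℝ, Sys G V (|E k| - μ₁) f g ∧
      0 < ∫ x in Ioi (0:ℝ), f x ^ 2 := by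
    intro k
    obtain ⟨ψ, ψ2, hne, hL, hC, hi, hbc, heq⟩ := hEeig k
    have p1 : Prim ψ (derivWithin ψ (Ici 0)) := prim_of_contDiffOn hC
    have p2 : Prim (derivWithin ψ (Ici 0)) ψ2 := fun b hb => hi 0 b le_rfl hb
    refine ⟨ψ, fun x => derivWithin ψ (Ici 0) x - G x * ψ x, ⟨?_, ?_, ?_, hL.integrable_sq⟩, ?_⟩
    · exact p1.congr_on (fun x _ => by ring)
    · refine (p2.sub (pG.mul p1)).congr_ae ?_
      filter_upwards [heq] with x hx
      rw [abs_of_neg (hEneg k)]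
      have : ψ2 x = (-E k - V₀ x - V x) * ψ x := by linarith
      rw [this]; ring
    · simp only [G0]; exact hbc
    · have h0 : 0 ≤ ∫ x in Ioi (0:ℝ), ψ x ^ 2 :=
        setIntegral_nonneg measurableSet_Ioi (fun x _ => sq_nonneg _)
      refine lt_of_le_of_ne h0 (fun h => hne ?_)
      have := (integral_eq_zero_iff_of_nonneg (fun x => sq_nonneg (ψ x)) hL.integrable_sq).1 h.symm
      filter_upwards [this] with x hx
      simpa using hx
  choose f g S hn using hsys
  set n : Fin N → ℝ := fun k => ∫ x in Ioi (0:ℝ), f k x ^ 2 with hndef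
  set d : Fin N → ℝ := fun k => max (Real.sqrt |E k| - s) 0 with hddef
  have hd0 : ∀ k, 0 ≤ d k := fun k => le_max_right _ _
  set c : Fin N → ℝ := fun k => Real.sqrt (d k / n k) with hcdef
  have key := core (d := d) (fun k => (S k).smul (c k)) hs0 hG hV (by
    intro i j
    have e : ∀ x, c i * f i x * (c j * f j x) = c i * c j * (f i x * f j x) := fun x => by ring
    simp_rw [e]
    rw [integral_const_mul]
    split_ifs with hij
    · subst hij
      have : ∫ x in Ioi (0:ℝ), f i x * f i x = n i := by
        simp only [hndef, sq]
      rw [this, ← sq, hcdef]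
      simp only
      rw [Real.sq_sqrt (div_nonneg (hd0 i) (hn i).le)]
      exact div_mul_cancel₀ _ (hn i).ne'
    · rw [(S i).orth (S j) hs0 hG hV ?_, mul_zero]
      intro h
      rw [abs_of_neg (hEneg i), abs_of_neg (hEneg j)] at h
      exact hij (hEdist (by linarith)))
  have hle : ∑ k, 2 / 3 * d k ^ 3
      ≤ ∑ i, (d i * (|E i| - μ₁) - d i ^ 3 / 3 - s * d i ^ 2) := by
    refine Finset.sum_le_sum (fun k _ => ?_)
    rcases le_total (Real.sqrt |E k| - s) 0 with h | h
    · have : d k = 0 := max_eq_right h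
      rw [this]; simp
    · have hdk : d k = Real.sqrt |E k| - s := max_eq_left h
      have h2 : |E k| = (d k + s) ^ 2 := by
        rw [hdk, sub_add_cancel, Real.sq_sqrt (abs_nonneg _)]
      rw [h2, ← hs2]
      nlinarith [mul_nonneg hs0 (sq_nonneg (d k))]
  rw [← Finset.mul_sum] at hle
  linarith
end
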